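/- Let (V,φ) be a quaternary nondegenerate quadratic space over a number field F, h ∈ V with φ[h]=q≠0, W=(Fh)^⊥, and ψ the restriction of φ to W. Fix an isomorphism ξ of (W,ψ) onto (A⁺(W)°, (ξξ*)⁻¹ν°) and write ξξ*g = 𝔞𝔯² with 𝔞 a squarefree integral ideal and 𝔯 a fractional g-ideal. Then for any g-maximal lattice L in V with respect to φ, (L∩W)ξ = 𝔯·𝔠·D_{Q(ψ)}·[M/L∩W]·(A⁺(L∩W)~ ∩ A⁺(W)°), where 𝔠 is the product of the prime factors of 𝔞 that are prime to the discriminant D_{Q(ψ)} of the quaternion algebra A⁺(W), and M is any g-maximal lattice in W with respect to ψ. -/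

import Mathlib

noncomputable section

namespace Paper

variable (R F : Type*) [CommRing R] [Field F] [Algebra R F]

section Lattices

variable (W : Type*) [AddCommGroup W] [Module F W] [Module R W] [IsScalarTower R F W]

/-- A `g`-lattice in `W`: a finitely generated `R`-submodule containing an `F`-basis. -/
def IsLat (L : Submodule R W) : Prop :=
  L.FG ∧ Submodule.span F (L : Set W) = ⊤

/-- integral lattice with respect to a bilinear form -/
def IsIntegralLat (ψ : LinearMap.BilinForm F W) (L : Submodule R W) : Prop :=
  IsLat R F W L ∧ ∀ x ∈ L, ψ x x ∈ (algebraMap R F).range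

/-- maximal lattice with respect to a bilinear form -/
def IsMaximalLat (ψ : LinearMap.BilinForm F W) (L : Submodule R W) : Prop :=
  IsIntegralLat R F W ψ L ∧ ∀ L' : Submodule R W, IsIntegralLat R F W ψ L' → L ≤ L' → L' = L

/-- the ideal `[L/M]` generated by determinants of `F`-automorphisms carrying `L` into `M` -/
def latIdx (L M : Submodule R W) : Submodule R F :=
  Submodule.span R {d : F | ∃ α : W ≃ₗ[F] W, (∀ x ∈ L, α x ∈ M) ∧
    LinearMap.det (α : W →ₗ[F] W) = d}

/-- the dual lattice `L~ = {x | 2ψ(x,L) ⊆ g}` -/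
def dualLat (ψ : LinearMap.BilinForm F W) (L : Submodule R W) : Submodule R W :=
  ⨅ y ∈ L, Submodule.comap (((2 : F) • (ψ.flip y)).restrictScalars R)
    (LinearMap.range (Algebra.linearMap R F))

/-- the ideal `[L/M]` for lattices spanning the subspace `U`, computed inside `U` -/
def latIdxIn (U : Submodule F W) (L M : Submodule R W) : Submodule R F :=
  latIdx R F ↥U (Submodule.comap ((U.subtype).restrictScalars R) L)
    (Submodule.comap ((U.subtype).restrictScalars R) M)

/-- product of a fractional ideal and a lattice -/
def idSMul {M : Type*} [AddCommGroup M] [Module F M] [Module R M] [IsScalarTower R F M]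
    (I : Submodule R F) (N : Submodule R M) : Submodule R M :=
  Submodule.span R {z : M | ∃ c ∈ I, ∃ x ∈ N, z = c • x}

end Lattices

/-- the fractional ideal attached to an integral ideal -/
def idealToF (I : Ideal R) : Submodule R F :=
  Submodule.map (Algebra.linearMap R F) I

section Clifford

variable (W : Type*) [AddCommGroup W] [Module F W] [Module R W] [IsScalarTower R F W]
variable (Q : QuadraticForm F W)

/-- the order `A(N)` generated by `g` and `N` in the Clifford algebra -/
def cliffordOrder (N : Submodule R W) : Subalgebra R (CliffordAlgebra Q) :=
  Algebra.adjoin R (CliffordAlgebra.ι Q '' (N : Set W))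

/-- the even Clifford algebra, as an `R`-subalgebra -/
def evenR : Subalgebra R (CliffordAlgebra Q) :=
  (CliffordAlgebra.even Q).restrictScalars R

/-- `A⁺(N) = A⁺(W) ∩ A(N)` -/
def APlus (N : Submodule R W) : Subalgebra R (CliffordAlgebra Q) :=
  evenR R F W Q ⊓ cliffordOrder R F W Q N

def APlusSub (N : Submodule R W) : Submodule R (CliffordAlgebra Q) :=
  Subalgebra.toSubmodule (APlus R F W Q N)

def oneLat : Submodule R (CliffordAlgebra Q) :=
  LinearMap.range (Algebra.linearMap R (CliffordAlgebra Q))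

/-- the `R`-linear map `x ↦ 2ν(x,y) = x·y* + y·x*`, where `*` is the canonical
involution (reversal) of the Clifford algebra -/
def traceMap (y : CliffordAlgebra Q) : CliffordAlgebra Q →ₗ[R] CliffordAlgebra Q :=
  ((LinearMap.mulRight F (CliffordAlgebra.reverse (Q := Q) y)) +
    (LinearMap.mulLeft F y) ∘ₗ (CliffordAlgebra.reverse (Q := Q))).restrictScalars R

/-- the dual `o~ = {x ∈ A⁺(W) | 2ν(x,o) ⊆ g}` with respect to the norm form
`ν[x] = x x*` of the even Clifford algebra -/
def normDual (o : Submodule R (CliffordAlgebra Q)) : Submodule R (CliffordAlgebra Q) :=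
  Subalgebra.toSubmodule (evenR R F W Q) ⊓
    ⨅ y ∈ o, Submodule.comap (traceMap R F W Q y) (oneLat R F W Q)

/-- `A⁺(W)° = {x ∈ A⁺(W) | x* = -x}`, as an `R`-submodule -/
def minusPart : Submodule R (CliffordAlgebra Q) :=
  Subalgebra.toSubmodule (evenR R F W Q) ⊓
    LinearMap.ker ((CliffordAlgebra.reverse (Q := Q) + LinearMap.id).restrictScalars R)

end Clifford

end Paper

namespace Paper

section Orders

variable (R F : Type*) [CommRing R] [Field F] [Algebra R F]
variable (A : Type*) [Ring A] [Algebra F A] [Algebra R A] [IsScalarTower R F A]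

/-- an order in the `F`-subalgebra `B` of `A`: an `R`-subalgebra which is an `R`-lattice
in `B` -/
def IsOrderIn (B : Subalgebra F A) (o : Subalgebra R A) : Prop :=
  (Subalgebra.toSubmodule o).FG ∧ (o : Set A) ⊆ (B : Set A) ∧
    Submodule.span F (o : Set A) = Subalgebra.toSubmodule B

/-- a maximal order in `B` -/
def IsMaximalOrderIn (B : Subalgebra F A) (o : Subalgebra R A) : Prop :=
  IsOrderIn R F A B o ∧ ∀ o' : Subalgebra R A, IsOrderIn R F A B o' → o ≤ o' → o' = o

end Orders

section Abbrev

variable (R F : Type*) [CommRing R] [Field F] [Algebra R F]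
variable (W : Type*) [AddCommGroup W] [Module F W] [Module R W] [IsScalarTower R F W]
variable (psi : LinearMap.BilinForm F W)

/-- the ideal `[A⁺(M)/A⁺(N)]`, computed inside the quaternion algebra `A⁺(W)` -/
def APlusIdx (M N : Submodule R W) : Submodule R F :=
  latIdxIn R F (CliffordAlgebra (LinearMap.BilinMap.toQuadraticMap psi))
    (Subalgebra.toSubmodule
      (CliffordAlgebra.even (LinearMap.BilinMap.toQuadraticMap psi)))
    (APlusSub R F W (LinearMap.BilinMap.toQuadraticMap psi) M)
    (APlusSub R F W (LinearMap.BilinMap.toQuadraticMap psi) N)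

/-- the ideal `[A⁺(N)~/A⁺(N)]`, computed inside the quaternion algebra `A⁺(W)` -/
def APlusDualIdx (N : Submodule R W) : Submodule R F :=
  latIdxIn R F (CliffordAlgebra (LinearMap.BilinMap.toQuadraticMap psi))
    (Subalgebra.toSubmodule
      (CliffordAlgebra.even (LinearMap.BilinMap.toQuadraticMap psi)))
    (normDual R F W (LinearMap.BilinMap.toQuadraticMap psi)
      (APlusSub R F W (LinearMap.BilinMap.toQuadraticMap psi) N))
    (APlusSub R F W (LinearMap.BilinMap.toQuadraticMap psi) N)

/-- the fractional ideal `2⁻¹·[Ñ/N]` -/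
def halfDualIdx (N : Submodule R W) : Submodule R F :=
  Submodule.span R {((2 : F)⁻¹)} * latIdx R F W (dualLat R F W psi N) N

end Abbrev

end Paper

open Paper NumberField IsDedekindDomain

section

section FiniteField

variable {k : Type*} [Field k] [Finite k]

/-- Squaring is surjective on a finite field of characteristic two. -/
theorem exists_sq_eq_of_two_eq_zero (h2 : (2 : k) = 0) (a : k) : ∃ s : k, s ^ 2 = a := by
  have hinj : Function.Injective (fun s : k => s ^ 2) := by
    intro s t hst
    have : (s - t) ^ 2 = 0 := by
      have h : s ^ 2 = t ^ 2 := hst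
      linear_combination h + (t ^ 2 - s * t) * h2
    exact sub_eq_zero.mp (by simpa using this)
  exact (Finite.injective_iff_surjective.mp hinj) a

theorem exists_singular_vector_binary (b u c : k) (h : u ^ 2 - 4 * b * c = 0) :
    ∃ y z : k, (y ≠ 0 ∨ z ≠ 0) ∧ b * y ^ 2 + u * y * z + c * z ^ 2 = 0 ∧
      2 * b * y + u * z = 0 ∧ u * y + 2 * c * z = 0 := by
  by_cases hu : u ≠ 0 ∨ 2 * b ≠ 0
  · refine ⟨u, -(2 * b), by simpa using hu, ?_, by ring, ?_⟩
    · linear_combination (-b) * h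
    · linear_combination h
  · push Not at hu
    obtain ⟨hu, hb⟩ := hu
    by_cases hb0 : b = 0
    · exact ⟨1, 0, by simp, by simp [hb0], by simp [hb0], by simp [hu]⟩
    · have h2 : (2 : k) = 0 := by simpa [hb0] using hb
      obtain ⟨s, hs⟩ := exists_sq_eq_of_two_eq_zero h2 b
      obtain ⟨t, ht⟩ := exists_sq_eq_of_two_eq_zero h2 c
      refine ⟨t, s, Or.inr ?_, ?_, by simp [h2, hu], by simp [h2, hu]⟩
      · rintro rfl; exact hb0 (by simp [← hs])
      · rw [hs, ht, hu]; linear_combination (b * c) * h2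

theorem exists_singular_vector_ternary (a b c u v w : k)
    (h : u * v * w + 4 * a * b * c - a * u ^ 2 - b * v ^ 2 - c * w ^ 2 = 0) :
    ∃ x y z : k, (x ≠ 0 ∨ y ≠ 0 ∨ z ≠ 0) ∧
      a * x ^ 2 + b * y ^ 2 + c * z ^ 2 + u * y * z + v * x * z + w * x * y = 0 ∧
      2 * a * x + w * y + v * z = 0 ∧ w * x + 2 * b * y + u * z = 0 ∧
      v * x + u * y + 2 * c * z = 0 := by
  by_cases h2 : (2 : k) = 0
  · by_cases huvw : u ≠ 0 ∨ v ≠ 0 ∨ w ≠ 0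
    · refine ⟨u, v, w, huvw, ?_, ?_, ?_, ?_⟩
      · linear_combination (-1 : k) * h + (2 * u * v * w + 2 * a * b * c) * h2
      · linear_combination (a * u + v * w) * h2
      · linear_combination (b * v + u * w) * h2
      · linear_combination (c * w + u * v) * h2
    · push Not at huvw
      obtain ⟨rfl, rfl, rfl⟩ := huvw
      obtain ⟨y, z, hyz, h1, -, -⟩ := exists_singular_vector_binary b 0 c
        (by linear_combination (-2 * b * c) * h2)
      refine ⟨0, y, z, by tauto, ?_, ?_, ?_, ?_⟩
      · linear_combination h1
      · ring
      · linear_combination (b * y) * h2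
      · linear_combination (c * z) * h2
  · have hdet : (!![2 * a, w, v; w, 2 * b, u; v, u, 2 * c] : Matrix (Fin 3) (Fin 3) k).det = 0 := by
      rw [Matrix.det_fin_three]
      simp
      linear_combination 2 * h
    obtain ⟨x, hx, hx0⟩ := Matrix.exists_mulVec_eq_zero_iff.mpr hdet
    have e0 := congrFun hx0 0
    have e1 := congrFun hx0 1
    have e2 := congrFun hx0 2
    simp [Matrix.mulVec, dotProduct, Fin.sum_univ_three] at e0 e1 e2
    refine ⟨x 0, x 1, x 2, ?_, ?_, by linear_combination e0, by linear_combination e1,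
      by linear_combination e2⟩
    · by_contra! hc
      apply hx
      ext i
      fin_cases i <;> simp [hc]
    · have : (2 : k) * (a * x 0 ^ 2 + b * x 1 ^ 2 + c * x 2 ^ 2 + u * x 1 * x 2 +
        v * x 0 * x 2 + w * x 0 * x 1) = 0 := by
        linear_combination x 0 * e0 + x 1 * e1 + x 2 * e2
      simpa [h2] using this

/-- A ternary quadratic form over a finite field is isotropic. -/
theorem exists_isotropic_vector_ternary (a b c u v w : k) :
    ∃ x y z : k, (x ≠ 0 ∨ y ≠ 0 ∨ z ≠ 0) ∧
      a * x ^ 2 + b * y ^ 2 + c * z ^ 2 + u * y * z + v * x * z + w * x * y = 0 := by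
  classical
  cases nonempty_fintype k
  obtain ⟨p, hp⟩ := CharP.exists k
  have : Fact p.Prime := ⟨CharP.char_is_prime k p⟩
  open MvPolynomial in
  let f : MvPolynomial (Fin 3) k :=
    C a * X 0 ^ 2 + C b * X 1 ^ 2 + C c * X 2 ^ 2 + C u * X 1 * X 2 + C v * X 0 * X 2 +
      C w * X 0 * X 1
  have hf : f.IsHomogeneous 2 := by
    have h1 : ∀ (r : k) (i j : Fin 3), (MvPolynomial.C r * MvPolynomial.X i *
        MvPolynomial.X j : MvPolynomial (Fin 3) k).IsHomogeneous 2 := fun r i j => by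
      have := ((MvPolynomial.isHomogeneous_C (Fin 3) r).mul
        (MvPolynomial.isHomogeneous_X k i)).mul (MvPolynomial.isHomogeneous_X k j)
      simpa using this
    have h2 : ∀ (r : k) (i : Fin 3), (MvPolynomial.C r * MvPolynomial.X i ^ 2 :
        MvPolynomial (Fin 3) k).IsHomogeneous 2 := fun r i => by
      simpa [sq, mul_assoc] using h1 r i i
    exact (((((h2 _ _).add (h2 _ _)).add (h2 _ _)).add (h1 _ _ _)).add (h1 _ _ _)).add (h1 _ _ _)
  have hdeg : f.totalDegree < Fintype.card (Fin 3) :=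
    lt_of_le_of_lt hf.totalDegree_le (by simp)
  have hdvd := char_dvd_card_solutions p hdeg
  have hmem0 : MvPolynomial.eval (0 : Fin 3 → k) f = 0 := by simp [f]
  have hcard : 1 < Fintype.card {x : Fin 3 → k // MvPolynomial.eval x f = 0} :=
    lt_of_lt_of_le (Fact.out : p.Prime).one_lt
      (Nat.le_of_dvd (Fintype.card_pos_iff.mpr ⟨⟨0, hmem0⟩⟩) hdvd)
  obtain ⟨⟨x, hx⟩, hne⟩ := Fintype.exists_ne_of_one_lt_card hcard ⟨0, hmem0⟩
  refine ⟨x 0, x 1, x 2, ?_, ?_⟩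
  · by_contra! hc
    apply hne
    ext i
    fin_cases i <;> simp [hc]
  · simpa [f] using hx

end FiniteField

/-- A ternary quadratic form
`a x² + b y² + c z² + u y z + v x z + w x y`, given by its coefficients. -/
@[ext]
structure TernaryForm (O : Type*) where
  (a b c u v w : O)

namespace TernaryForm

variable {O : Type*} [CommRing O]

/-- The value of the form. -/
def eval (T : TernaryForm O) (x : Fin 3 → O) : O :=
  T.a * x 0 ^ 2 + T.b * x 1 ^ 2 + T.c * x 2 ^ 2 + T.u * x 1 * x 2 + T.v * x 0 * x 2 +
    T.w * x 0 * x 1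

/-- The polar form. -/
def polar (T : TernaryForm O) (x y : Fin 3 → O) : O :=
  2 * T.a * x 0 * y 0 + 2 * T.b * x 1 * y 1 + 2 * T.c * x 2 * y 2 +
    T.u * (x 1 * y 2 + x 2 * y 1) + T.v * (x 0 * y 2 + x 2 * y 0) +
    T.w * (x 0 * y 1 + x 1 * y 0)

/-- The half-discriminant. -/
def disc (T : TernaryForm O) : O :=
  T.u * T.v * T.w + 4 * T.a * T.b * T.c - T.a * T.u ^ 2 - T.b * T.v ^ 2 - T.c * T.w ^ 2

/-- The form in the coordinates given by the rows of a matrix. -/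
def subst (T : TernaryForm O) (P : Matrix (Fin 3) (Fin 3) O) : TernaryForm O :=
  ⟨T.eval (P 0), T.eval (P 1), T.eval (P 2), T.polar (P 1) (P 2), T.polar (P 0) (P 2),
    T.polar (P 0) (P 1)⟩

theorem disc_subst (T : TernaryForm O) (P : Matrix (Fin 3) (Fin 3) O) :
    (T.subst P).disc = P.det ^ 2 * T.disc := by
  simp only [disc, subst, eval, polar, Matrix.det_fin_three]
  ring

theorem subst_mul (T : TernaryForm O) (P S : Matrix (Fin 3) (Fin 3) O) :
    T.subst (S * P) = (T.subst P).subst S := by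
  ext <;> simp only [TernaryForm.subst, eval, polar, Matrix.mul_apply, Fin.sum_univ_three] <;> ring

/-- A form is maximal at `π` when the lattice `O³` cannot be enlarged inside `π⁻¹O³`. -/
def MaximalAt (T : TernaryForm O) (π : O) : Prop :=
  ∀ x : Fin 3 → O, π ^ 2 ∣ T.eval x → (∀ i, π ∣ T.polar x (Pi.single i 1)) → ∀ i, π ∣ x i

theorem MaximalAt.subst {T : TernaryForm O} {π : O} (hT : T.MaximalAt π)
    {P : Matrix (Fin 3) (Fin 3) O} (hP : IsUnit P.det) : (T.subst P).MaximalAt π := by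
  intro x hx hpx
  have hPinv : P⁻¹ * P = 1 := Matrix.nonsing_inv_mul P hP
  have hPinv' : P * P⁻¹ = 1 := Matrix.mul_nonsing_inv P hP
  set y : Fin 3 → O := Matrix.vecMul x P with hy
  have hev : T.eval y = (T.subst P).eval x := by
    simp only [hy, eval, TernaryForm.subst, polar, Matrix.vecMul, dotProduct, Fin.sum_univ_three]
    ring
  have hpol : ∀ i, T.polar y (P i) = (T.subst P).polar x (Pi.single i 1) := by
    intro i
    fin_cases i <;>
    simp [hy, eval, TernaryForm.subst, polar, Matrix.vecMul, dotProduct, Fin.sum_univ_three] <;>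
    ring
  have hlin : ∀ (z : Fin 3 → O), T.polar y (Matrix.vecMul z P) = ∑ j, z j * T.polar y (P j) := by
    intro z
    simp only [polar, Matrix.vecMul, dotProduct, Fin.sum_univ_three]
    ring
  have hdiv : ∀ i, π ∣ y i := by
    refine hT y (hev ▸ hx) fun i => ?_
    have : (Pi.single i 1 : Fin 3 → O) = Matrix.vecMul (Matrix.vecMul (Pi.single i 1) P⁻¹) P := by
      rw [Matrix.vecMul_vecMul, hPinv, Matrix.vecMul_one]
    rw [this, hlin]
    exact Finset.dvd_sum fun j _ => Dvd.dvd.mul_left (hpol j ▸ hpx j) _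
  intro i
  have hxy : x = Matrix.vecMul y P⁻¹ := by
    rw [hy, Matrix.vecMul_vecMul, hPinv', Matrix.vecMul_one]
  rw [hxy, Matrix.vecMul, dotProduct]
  exact Finset.dvd_sum fun j _ => Dvd.dvd.mul_right (hdiv j) _

/-- A vector with an invertible coordinate can be completed to a basis. -/
theorem exists_matrix_row_zero (x : Fin 3 → O) (hx : ∃ i, IsUnit (x i)) :
    ∃ P : Matrix (Fin 3) (Fin 3) O, IsUnit P.det ∧ P 0 = x := by
  obtain ⟨i, hi⟩ := hx
  fin_cases i
  · refine ⟨!![x 0, x 1, x 2; 0, 1, 0; 0, 0, 1], ?_, ?_⟩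
    · rw [Matrix.det_fin_three]; simpa using hi
    · ext j; fin_cases j <;> simp
  · refine ⟨!![x 0, x 1, x 2; 1, 0, 0; 0, 0, 1], ?_, ?_⟩
    · rw [Matrix.det_fin_three]; simpa using hi
    · ext j; fin_cases j <;> simp
  · refine ⟨!![x 0, x 1, x 2; 1, 0, 0; 0, 1, 0], ?_, ?_⟩
    · rw [Matrix.det_fin_three]; simpa using hi
    · ext j; fin_cases j <;> simp

/-- A pair with an invertible entry can be completed to a change of the last two coordinates. -/
theorem exists_matrix_row_one (y z : O) (h : IsUnit y ∨ IsUnit z) :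
    ∃ s t : O, IsUnit (!![1, 0, 0; 0, y, z; 0, s, t] : Matrix (Fin 3) (Fin 3) O).det := by
  rcases h with h | h
  · refine ⟨0, 1, ?_⟩
    rw [Matrix.det_fin_three]; simpa using h
  · refine ⟨1, 0, ?_⟩
    rw [Matrix.det_fin_three]; simpa using h

section Local

variable {k : Type*} [Field k] [Finite k] (res : O →+* k) {π : O}

theorem exists_isUnit_polar (hsurj : Function.Surjective res)
    (hres : ∀ x, res x = 0 ↔ π ∣ x) (hunit : ∀ x, IsUnit x ↔ ¬ π ∣ x)
    (T : TernaryForm O) (hdisc : ¬ π ∣ T.disc) :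
    ∃ x y : Fin 3 → O, π ∣ T.eval x ∧ IsUnit (T.polar x y) := by
  obtain ⟨x, y, z, hxyz, h0⟩ := exists_isotropic_vector_ternary (res T.a) (res T.b) (res T.c)
    (res T.u) (res T.v) (res T.w)
  obtain ⟨x, rfl⟩ := hsurj x
  obtain ⟨y, rfl⟩ := hsurj y
  obtain ⟨z, rfl⟩ := hsurj z
  obtain ⟨P, hP, hP0⟩ := exists_matrix_row_zero ![x, y, z] (by
    simp only [ne_eq, hres, ← hunit] at hxyz
    rcases hxyz with h | h | h
    exacts [⟨0, h⟩, ⟨1, h⟩, ⟨2, h⟩])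
  have ha : π ∣ T.eval (P 0) := by
    rw [← hres, hP0]
    simpa [eval] using h0
  by_contra! hcon
  have hpol : ∀ j, π ∣ T.polar (P 0) (P j) := fun j => by
    have := hcon (P 0) (P j) ha
    rwa [hunit, not_not] at this
  apply hdisc
  have hd : π ∣ (T.subst P).disc := by
    have h1 := hpol 1
    have h2 := hpol 2
    simp only [disc, TernaryForm.subst]
    refine dvd_sub (dvd_sub (dvd_sub (dvd_add ?_ ?_) ?_) ?_) ?_
    · exact Dvd.dvd.mul_left h1 _
    · exact Dvd.dvd.mul_right (Dvd.dvd.mul_right (Dvd.dvd.mul_left ha _) _) _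
    · exact Dvd.dvd.mul_right ha _
    · exact Dvd.dvd.mul_left (h2.trans (dvd_pow_self _ two_ne_zero)) _
    · exact Dvd.dvd.mul_left (h1.trans (dvd_pow_self _ two_ne_zero)) _
  rw [disc_subst] at hd
  exact ((hP.pow 2).dvd_mul_left).mp hd

/-- A form `π a x² + π b y² + c z² + π u y z + π v x z + π w x y` with `c` invertible and
`a x² + w x y + b y²` anisotropic modulo `π`. -/
structure IsAnisotropicAt (T : TernaryForm O) (π : O) (a b u v w : O) : Prop where
  ha : T.a = π * a
  hb : T.b = π * b
  hc : IsUnit T.c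
  hu : T.u = π * u
  hv : T.v = π * v
  hw : T.w = π * w
  aniso : ∀ x y : O, π ∣ a * x ^ 2 + w * x * y + b * y ^ 2 → π ∣ x ∧ π ∣ y

theorem MaximalAt.disc_cases_of_dvd (hsurj : Function.Surjective res)
    (hres : ∀ x, res x = 0 ↔ π ∣ x) (hunit : ∀ x, IsUnit x ↔ ¬ π ∣ x)
    {T : TernaryForm O} (hT : T.MaximalAt π) (ha : π ∣ T.a) (hv : π ∣ T.v) (hw : π ∣ T.w) :
    (∃ d, IsUnit d ∧ T.disc = π * d) ∨
    ((∃ d, IsUnit d ∧ T.disc = π ^ 2 * d) ∧ ∃ P : Matrix (Fin 3) (Fin 3) O, IsUnit P.det ∧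
      ∃ a b u v w, (T.subst P).IsAnisotropicAt π a b u v w) := by
  have hp1 : ¬ π ∣ 1 := by rw [← hunit]; exact isUnit_one
  have hprime : ∀ x y, π ∣ x * y → π ∣ x ∨ π ∣ y := by
    intro x y h
    rw [← hres, map_mul, mul_eq_zero] at h
    simpa [hres] using h
  by_cases hbc : π ∣ T.u ^ 2 - 4 * T.b * T.c
  · right
    obtain ⟨y, z, hyz, h1, h2, h3⟩ := exists_singular_vector_binary (res T.b) (res T.u)
      (res T.c) (by simpa [map_ofNat] using (hres _).mpr hbc)
    obtain ⟨y, rfl⟩ := hsurj y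
    obtain ⟨z, rfl⟩ := hsurj z
    obtain ⟨s, t, hN⟩ := exists_matrix_row_one y z (by
      simpa only [ne_eq, hres, ← hunit] using hyz)
    set N : Matrix (Fin 3) (Fin 3) O := !![1, 0, 0; 0, y, z; 0, s, t] with hNdef
    have hmax := hT.subst hN
    have hdisc := disc_subst T N
    have ha' : π ∣ (T.subst N).a := by
      simpa [TernaryForm.subst, eval, hNdef] using ha
    have hb' : π ∣ (T.subst N).b := by
      rw [← hres]
      simp [TernaryForm.subst, eval, hNdef]
      linear_combination h1
    have hu' : π ∣ (T.subst N).u := by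
      rw [← hres]
      simp [TernaryForm.subst, polar, hNdef, map_ofNat]
      linear_combination (res s) * h2 + (res t) * h3
    have hv' : π ∣ (T.subst N).v := by
      simp [TernaryForm.subst, polar, hNdef]
      exact dvd_add (hv.mul_right _) (hw.mul_right _)
    have hw' : π ∣ (T.subst N).w := by
      simp [TernaryForm.subst, polar, hNdef]
      exact dvd_add (hv.mul_right _) (hw.mul_right _)
    suffices h : (∃ d, IsUnit d ∧ (T.subst N).disc = π ^ 2 * d) ∧
        ∃ a b u v w, (T.subst N).IsAnisotropicAt π a b u v w by
      obtain ⟨⟨d, hd, hd'⟩, h⟩ := h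
      refine ⟨?_, N, hN, h⟩
      obtain ⟨n, hn⟩ := hN
      refine ⟨↑(n⁻¹) ^ 2 * d, (((n⁻¹).isUnit).pow 2).mul hd, ?_⟩
      have : T.disc = ↑(n⁻¹) ^ 2 * (T.subst N).disc := by
        rw [hdisc, ← hn, ← mul_assoc, ← mul_pow, Units.inv_mul, one_pow, one_mul]
      rw [this, hd']; ring
    generalize T.subst N = S at *
    obtain ⟨a, ha⟩ := ha'
    obtain ⟨b, hb⟩ := hb'
    obtain ⟨u, hu⟩ := hu'
    obtain ⟨v, hv⟩ := hv'
    obtain ⟨w, hw⟩ := hw'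
    have haniso : ∀ x y : O, π ∣ a * x ^ 2 + w * x * y + b * y ^ 2 → π ∣ x ∧ π ∣ y := by
      rintro x y ⟨r, hr⟩
      have := hmax ![x, y, 0] ⟨r, by simp [eval, ha, hb, hw]; linear_combination π * hr⟩ (by
        intro i
        fin_cases i
        · exact ⟨2 * a * x + w * y, by simp [polar, ha, hb, hw, hu, hv]; ring⟩
        · exact ⟨2 * b * y + w * x, by simp [polar, ha, hb, hw, hu, hv]; ring⟩
        · exact ⟨u * y + v * x, by simp [polar, ha, hb, hw, hu, hv]; ring⟩)
      exact ⟨by simpa using this 0, by simpa using this 1⟩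
    have hab : ¬ π ∣ w ^ 2 - 4 * a * b := by
      intro h
      obtain ⟨x, y, hxy, h1, -, -⟩ := exists_singular_vector_binary (res a) (res w)
        (res b) (by simpa [map_ofNat] using (hres _).mpr h)
      obtain ⟨x, rfl⟩ := hsurj x
      obtain ⟨y, rfl⟩ := hsurj y
      have := haniso x y (by rw [← hres]; simpa using h1)
      simp only [ne_eq, hres] at hxy
      tauto
    have hc : ¬ π ∣ S.c := by
      rintro ⟨c, hc⟩
      obtain ⟨x, y, z, hxyz, h0⟩ := exists_isotropic_vector_ternary (res a) (res b) (res c)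
        (res u) (res v) (res w)
      obtain ⟨x, rfl⟩ := hsurj x
      obtain ⟨y, rfl⟩ := hsurj y
      obtain ⟨z, rfl⟩ := hsurj z
      obtain ⟨r, hr⟩ : π ∣ a * x ^ 2 + b * y ^ 2 + c * z ^ 2 + u * y * z + v * x * z +
          w * x * y := by
        rw [← hres]; simpa using h0
      have := hmax ![x, y, z] ⟨r, by
          simp [eval, ha, hb, hw, hc, hu, hv]; linear_combination π * hr⟩ (by
        intro i
        fin_cases i
        · exact ⟨2 * a * x + w * y + v * z, by simp [polar, ha, hb, hw, hu, hv, hc]; ring⟩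
        · exact ⟨2 * b * y + w * x + u * z, by simp [polar, ha, hb, hw, hu, hv, hc]; ring⟩
        · exact ⟨u * y + v * x + 2 * c * z, by simp [polar, ha, hb, hw, hu, hv, hc]; ring⟩)
      simp only [ne_eq, hres] at hxyz
      have e0 : π ∣ x := this 0
      have e1 : π ∣ y := this 1
      have e2 : π ∣ z := this 2
      tauto
    refine ⟨⟨S.c * (4 * a * b - w ^ 2) + π * (u * v * w - a * u ^ 2 - b * v ^ 2), ?_, ?_⟩,
      a, b, u, v, w, ha, hb, (hunit _).mpr hc, hu, hv, hw, haniso⟩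
    · rw [hunit]
      intro h
      rw [dvd_add_left (dvd_mul_right _ _)] at h
      rcases hprime _ _ h with h | h
      · exact hc h
      · exact hab ((dvd_neg.mpr h).trans (by rw [neg_sub]))
    · simp only [disc, ha, hb, hu, hv, hw]; ring
  · left
    have ha2 : ¬ π ^ 2 ∣ T.a := by
      intro h
      have h0 : ∀ i, π ∣ T.polar ![1, 0, 0] (Pi.single i 1) := fun i => by
        fin_cases i
        · simpa [polar] using ha.mul_left _
        · simpa [polar] using hw
        · simpa [polar] using hv
      have h1 := hT ![1, 0, 0] (by simpa [eval] using h) h0 0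
      exact hp1 (by simpa using h1)
    obtain ⟨a, ha⟩ := ha
    obtain ⟨v, hv⟩ := hv
    obtain ⟨w, hw⟩ := hw
    refine ⟨a * (4 * T.b * T.c - T.u ^ 2) + π * (T.u * v * w - T.b * v ^ 2 - T.c * w ^ 2),
      ?_, ?_⟩
    · rw [hunit]
      intro h
      rw [dvd_add_left (dvd_mul_right _ _)] at h
      rcases hprime _ _ h with h | h
      · exact ha2 (by rw [ha, sq]; exact mul_dvd_mul_left _ h)
      · exact hbc ((dvd_neg.mpr h).trans (by rw [neg_sub]))
    · simp only [disc, ha, hv, hw]; ring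

theorem MaximalAt.disc_cases (hsurj : Function.Surjective res)
    (hres : ∀ x, res x = 0 ↔ π ∣ x) (hunit : ∀ x, IsUnit x ↔ ¬ π ∣ x)
    {T : TernaryForm O} (hT : T.MaximalAt π) (hdisc : π ∣ T.disc) :
    (∃ d, IsUnit d ∧ T.disc = π * d) ∨
    ((∃ d, IsUnit d ∧ T.disc = π ^ 2 * d) ∧ ∃ P : Matrix (Fin 3) (Fin 3) O, IsUnit P.det ∧
      ∃ a b u v w, (T.subst P).IsAnisotropicAt π a b u v w) := by
  obtain ⟨x, y, z, hxyz, h0, h1, h2, h3⟩ := exists_singular_vector_ternary (res T.a) (res T.b)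
    (res T.c) (res T.u) (res T.v) (res T.w)
    (by simpa [disc, map_ofNat] using (hres _).mpr hdisc)
  obtain ⟨x, rfl⟩ := hsurj x
  obtain ⟨y, rfl⟩ := hsurj y
  obtain ⟨z, rfl⟩ := hsurj z
  obtain ⟨P, hP, hP0⟩ := exists_matrix_row_zero ![x, y, z] (by
    simp only [ne_eq, hres, ← hunit] at hxyz
    rcases hxyz with h | h | h
    exacts [⟨0, h⟩, ⟨1, h⟩, ⟨2, h⟩])
  have hpol : ∀ s, π ∣ T.polar (P 0) s := fun s => by
    rw [← hres, hP0]
    simp [polar, map_ofNat]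
    linear_combination (res (s 0)) * h1 + (res (s 1)) * h2 + (res (s 2)) * h3
  have key := (hT.subst hP).disc_cases_of_dvd res hsurj hres hunit
    (by simp only [TernaryForm.subst]; rw [← hres, hP0]; simpa [eval] using h0) (hpol _) (hpol _)
  have hdP := disc_subst T P
  obtain ⟨n, hn⟩ := id hP
  have hTS : T.disc = ↑(n⁻¹) ^ 2 * (T.subst P).disc := by
    rw [hdP, ← hn, ← mul_assoc, ← mul_pow, Units.inv_mul, one_pow, one_mul]
  have hn2 : IsUnit ((↑(n⁻¹) : O) ^ 2) := (n⁻¹).isUnit.pow 2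
  rcases key with ⟨d, hd, h⟩ | ⟨⟨d, hd, h⟩, N, hN, h'⟩
  · exact Or.inl ⟨_, hn2.mul hd, by rw [hTS, h]; ring⟩
  · refine Or.inr ⟨⟨_, hn2.mul hd, by rw [hTS, h]; ring⟩, N * P, ?_, ?_⟩
    · rw [Matrix.det_mul]; exact hN.mul hP
    · rwa [subst_mul]

end Local

end TernaryForm

end

section

open IsDedekindDomain

section Anisotropic

open WithZero

theorem Valuation.max_pow_le_of_aniso {K : Type*} [Field K] (V : Valuation K (WithZero (Multiplicative ℤ)))
    {a b c u v w p : K} (ha : V a ≤ 1) (hb : V b ≤ 1) (hc : V c = 1) (hu : V u ≤ 1)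
    (hv : V v ≤ 1) (hw : V w ≤ 1) (hp : V p = exp (-1 : ℤ))
    (haniso : ∀ x y, V (a * x ^ 2 + w * x * y + b * y ^ 2) = max (V x) (V y) ^ 2)
    (t z x y : K) (h : t ^ 2 + w * t * z + a * b * z ^ 2 +
      p * (c * (a * x ^ 2 + w * x * y + b * y ^ 2)) +
      p * (t * (v * x + u * y) + z * (u * a * x + (u * w - b * v) * y)) = 0) :
    t = 0 ∧ z = 0 ∧ x = 0 ∧ y = 0 := by
  have ha1 : V a = 1 := by simpa using haniso 1 0
  set A := max (V t) (V z) with hA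
  set C := max (V x) (V y) with hC
  have hp1 : V p < 1 := by rw [hp, ← exp_zero, exp_lt_exp]; norm_num
  have hp0 : V p ≠ 0 := by rw [hp]; exact exp_ne_zero
  have h1 : V (t ^ 2 + w * t * z + a * b * z ^ 2) = A ^ 2 := by
    have := haniso t (a * z)
    rw [map_mul, ha1, one_mul, ← hA] at this
    rw [← this, ← one_mul (V (t ^ 2 + _ + _)), ← ha1, ← map_mul]
    congr 1; ring
  have h2 : V (p * (c * (a * x ^ 2 + w * x * y + b * y ^ 2))) = V p * C ^ 2 := by
    rw [map_mul, map_mul, hc, one_mul, haniso]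
  have ht : V t ≤ A := le_max_left _ _
  have hz : V z ≤ A := le_max_right _ _
  have hx : V x ≤ C := le_max_left _ _
  have hy : V y ≤ C := le_max_right _ _
  have hmul : ∀ {r s : K} {ρ : WithZero (Multiplicative ℤ)}, V r ≤ 1 → V s ≤ ρ → V (r * s) ≤ ρ :=
    fun hr hs => by rw [map_mul]; exact (mul_le_mul' hr hs).trans (by rw [one_mul])
  have h3 : V (p * (t * (v * x + u * y) + z * (u * a * x + (u * w - b * v) * y))) ≤
      V p * (A * C) := by
    rw [map_mul]
    gcongr
    refine V.map_add_le ?_ ?_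
    · rw [map_mul]
      exact mul_le_mul' ht (V.map_add_le (hmul hv hx) (hmul hu hy))
    · rw [map_mul]
      refine mul_le_mul' hz (V.map_add_le (hmul (hmul hu ha) hx) (hmul ?_ hy))
      exact V.map_sub_le (hmul hu hw) (hmul hb hv)
  have hzero : ∀ {r s : K}, max (V r) (V s) = 0 → r = 0 ∧ s = 0 := fun {r s} h => by
    have h' := h.le
    rw [max_le_iff] at h'
    exact ⟨(map_eq_zero V).mp (le_antisymm h'.1 zero_le), (map_eq_zero V).mp
      (le_antisymm h'.2 zero_le)⟩
  suffices h : A = 0 ∧ C = 0 by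
    obtain ⟨h1, h2⟩ := h
    exact ⟨(hzero h1).1, (hzero h1).2, (hzero h2).1, (hzero h2).2⟩
  by_cases hAC : C ≤ A
  · have hA0 : A = 0 := by
      by_contra hA0
      have hlt : V (p * (c * (a * x ^ 2 + w * x * y + b * y ^ 2)) +
          p * (t * (v * x + u * y) + z * (u * a * x + (u * w - b * v) * y))) < A ^ 2 := by
        have : V p * A ^ 2 < A ^ 2 := by
          calc V p * A ^ 2 < 1 * A ^ 2 := by gcongr; exact zero_lt_iff.mpr (pow_ne_zero _ hA0)
            _ = _ := one_mul _
        refine lt_of_le_of_lt (V.map_add_le ?_ (h3.trans ?_)) this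
        · rw [h2]; gcongr
        · rw [sq]; gcongr
      rw [← h1] at hlt
      have := V.map_add_eq_of_lt_right hlt
      rw [add_comm, ← add_assoc, h, map_zero, h1] at this
      exact hA0 (pow_eq_zero_iff two_ne_zero |>.mp this.symm)
    exact ⟨hA0, le_antisymm (hA0 ▸ hAC) zero_le⟩
  · push Not at hAC
    have hC0 : C ≠ 0 := (zero_le.trans_lt hAC).ne'
    have hAp : A ≤ V p * C := by
      rcases eq_or_ne A 0 with h0 | h0
      · rw [h0]; exact zero_le
      · rw [hp]
        rw [← exp_log h0, ← exp_log hC0, exp_lt_exp] at hAC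
        rw [← exp_log h0, ← exp_log hC0, ← exp_add, exp_le_exp]
        lia
    exfalso
    have hlt : V ((t ^ 2 + w * t * z + a * b * z ^ 2) +
          p * (t * (v * x + u * y) + z * (u * a * x + (u * w - b * v) * y))) < V p * C ^ 2 := by
      have : V p * (V p * C ^ 2) < V p * C ^ 2 := by
        calc V p * (V p * C ^ 2) < 1 * (V p * C ^ 2) := by
              gcongr
              exact zero_lt_iff.mpr (mul_ne_zero hp0 (pow_ne_zero _ hC0))
          _ = _ := one_mul _
      refine lt_of_le_of_lt (V.map_add_le ?_ (h3.trans ?_)) this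
      · rw [h1]
        calc A ^ 2 ≤ (V p * C) ^ 2 := by gcongr
          _ = _ := by rw [mul_pow, sq, mul_assoc]
      · calc V p * (A * C) ≤ V p * (V p * C * C) := by gcongr
          _ = _ := by rw [sq, mul_assoc]
    rw [← h2] at hlt
    have := V.map_add_eq_of_lt_right hlt
    rw [add_right_comm, h, map_zero, h2] at this
    exact mul_ne_zero hp0 (pow_ne_zero _ hC0) this.symm

end Anisotropic

section Completion
variable {R F : Type*} [CommRing R] [IsDedekindDomain R] [Field F] [Algebra R F]
  [IsFractionRing R F] (v : HeightOneSpectrum R)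

theorem valued_algebraMap (f : F) :
    Valued.v (algebraMap F (v.adicCompletion F) f) = v.valuation F f :=
  HeightOneSpectrum.valuedAdicCompletion_eq_valuation' v f

theorem exists_valued_sub_algebraMap_lt_one (x : v.adicCompletion F) :
    ∃ f : F, Valued.v (x - algebraMap F (v.adicCompletion F) f) < 1 := by
  have h : {y : v.adicCompletion F | Valued.v (y - x) < 1} ∈ nhds x := by
    rw [Valued.mem_nhds]
    exact ⟨1, fun y hy => by
      simpa [Valuation.restrict_lt_iff_lt_embedding] using hy⟩
  obtain ⟨y, hy, f, rfl⟩ := mem_closure_iff_nhds.mp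
    (HeightOneSpectrum.denseRange_algebraMap F v x) _ h
  exact ⟨f, by rw [Valuation.map_sub_swap]; exact hy⟩

theorem exists_root_of_valued_lt_one {ε : v.adicCompletion F} (hε : Valued.v ε < 1) :
    ∃ y : v.adicCompletion F, y ^ 2 - y + ε = 0 := by
  obtain ⟨u, hu0, hu⟩ : ∃ u : ℕ → v.adicCompletion F, u 0 = ε ∧ ∀ n, u (n + 1) = ε + u n ^ 2 :=
    ⟨fun n => Nat.rec ε (fun _ y => ε + y ^ 2) n, rfl, fun n => rfl⟩
  have hle : ∀ n, Valued.v (u n) ≤ Valued.v ε := by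
    intro n
    induction n with
    | zero => rw [hu0]
    | succ n ih =>
      rw [hu]
      refine Valuation.map_add_le _ le_rfl ?_
      rw [sq, map_mul]
      exact (mul_le_mul' (ih.trans hε.le) ih).trans (by rw [one_mul])
  have hdiff : ∀ n, Valued.v (u (n + 1) - u n) ≤ Valued.v ε ^ (n + 1) := by
    intro n
    induction n with
    | zero =>
      rw [zero_add, pow_one]
      exact Valuation.map_sub_le _ (hle _) (hle _)
    | succ n ih =>
      have : u (n + 1 + 1) - u (n + 1) = (u (n + 1) + u n) * (u (n + 1) - u n) := by
        rw [hu (n + 1), hu n]; ring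
      rw [this, map_mul, pow_succ' _ (n + 1)]
      exact mul_le_mul' (Valuation.map_add_le _ (hle _) (hle _)) ih
  have hdiff' : ∀ n m, Valued.v (u (n + m) - u n) ≤ Valued.v ε ^ (n + 1) := by
    intro n m
    induction m with
    | zero => simp
    | succ m ih =>
      have : u (n + (m + 1)) - u n = (u (n + m + 1) - u (n + m)) + (u (n + m) - u n) := by
        rw [← add_assoc]; ring
      rw [this]
      refine Valuation.map_add_le _ ((hdiff _).trans ?_) ih
      exact pow_le_pow_right_of_le_one' hε.le (by lia)
  have hsmall : ∀ γ : (WithZero (Multiplicative ℤ)), γ ≠ 0 → ∃ n, Valued.v ε ^ n < γ := by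
    intro γ hγ
    exact exists_pow_lt₀ hε (Units.mk0 γ hγ)
  have hcauchy : CauchySeq u := by
    rw [CauchySeq, Valued.cauchy_iff]
    refine ⟨inferInstance, fun γ => ?_⟩
    obtain ⟨n, hn⟩ := hsmall (MonoidWithZeroHom.ValueGroup₀.embedding γ.1) (by simp)
    refine ⟨u '' Set.Ici n, Filter.image_mem_map (Filter.mem_atTop n), ?_⟩
    rintro _ ⟨i, hi, rfl⟩ _ ⟨j, hj, rfl⟩
    rw [Valuation.restrict_lt_iff_lt_embedding]
    refine lt_of_le_of_lt ?_ hn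
    obtain ⟨i, rfl⟩ := Nat.exists_eq_add_of_le hi
    obtain ⟨j, rfl⟩ := Nat.exists_eq_add_of_le hj
    have : u (n + j) - u (n + i) = (u (n + j) - u n) - (u (n + i) - u n) := by ring
    rw [this]
    exact (Valuation.map_sub_le _ (hdiff' _ _) (hdiff' _ _)).trans
      (pow_le_pow_right_of_le_one' hε.le (by lia))
  obtain ⟨y, hy⟩ := cauchySeq_tendsto_of_complete hcauchy
  refine ⟨y, ?_⟩
  have h1 : Filter.Tendsto (fun n => u n ^ 2 - u n + ε) Filter.atTop (nhds (y ^ 2 - y + ε)) :=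
    ((hy.pow 2).sub hy).add_const ε
  have h2 : Filter.Tendsto (fun n => u n ^ 2 - u n + ε) Filter.atTop (nhds (y - y)) := by
    have : (fun n => u n ^ 2 - u n + ε) = fun n => u (n + 1) - u n :=
      funext fun n => by linear_combination -hu n
    rw [this]
    exact (hy.comp (Filter.tendsto_add_atTop_nat 1)).sub hy
  rw [tendsto_nhds_unique h1 h2, sub_self]

/-- Two factors of a monic quadratic polynomial with unit trace and topologically nilpotent
norm exist over the completion. -/
theorem exists_root_quadratic {t n : F} (ht : v.valuation F t = 1) (hn : v.valuation F n < 1) :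
    ∃ y : v.adicCompletion F, y ^ 2 - algebraMap F _ t * y + algebraMap F _ n = 0 := by
  have ht0 : t ≠ 0 := fun h => by simp [h] at ht
  obtain ⟨y, hy⟩ := exists_root_of_valued_lt_one v
    (ε := algebraMap F (v.adicCompletion F) (n / t ^ 2)) (by
      rw [valued_algebraMap, map_div₀, map_pow, ht]; simpa using hn)
  refine ⟨algebraMap F _ t * y, ?_⟩
  have h : algebraMap F (v.adicCompletion F) n = algebraMap F _ t ^ 2 *
      algebraMap F (v.adicCompletion F) (n / t ^ 2) := by
    rw [← map_pow, ← map_mul]; congr 1; field_simp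
  rw [h]
  linear_combination (algebraMap F _ t) ^ 2 * hy

/-- An anisotropic reduction gives an anisotropic form over the completion. -/
theorem valued_eq_max_of_aniso {a b w : F} (ha : v.valuation F a ≤ 1) (hb : v.valuation F b ≤ 1)
    (hw : v.valuation F w ≤ 1)
    (h : ∀ x y, v.valuation F x ≤ 1 → v.valuation F y ≤ 1 →
      v.valuation F (a * x ^ 2 + w * x * y + b * y ^ 2) < 1 →
        v.valuation F x < 1 ∧ v.valuation F y < 1) (x y : v.adicCompletion F) :
    Valued.v (algebraMap F _ a * x ^ 2 + algebraMap F _ w * x * y + algebraMap F _ b * y ^ 2) =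
      max (Valued.v x) (Valued.v y) ^ 2 := by
  have key : ∀ a b : F, v.valuation F a ≤ 1 → v.valuation F b ≤ 1 →
      (∀ y, v.valuation F y ≤ 1 → v.valuation F (a + w * y + b * y ^ 2) = 1) →
      ∀ x y : v.adicCompletion F, Valued.v y ≤ Valued.v x →
      Valued.v (algebraMap F _ a * x ^ 2 + algebraMap F _ w * x * y + algebraMap F _ b * y ^ 2) =
      Valued.v x ^ 2 := by
    intro a b ha hb h x y hxy
    rcases eq_or_ne x 0 with rfl | hx
    · have : y = 0 := by simpa using hxy
      simp [this]
    obtain ⟨f, hf⟩ := exists_valued_sub_algebraMap_lt_one v (y / x)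
    set z := y / x with hz
    have hzv : Valued.v z ≤ 1 := by
      rw [hz, map_div₀]
      exact div_le_one_of_le₀ hxy zero_le
    have hfv : v.valuation F f ≤ 1 := by
      rw [← valued_algebraMap v]
      have : algebraMap F (v.adicCompletion F) f = z - (z - algebraMap F _ f) := by ring
      rw [this]
      exact Valuation.map_sub_le _ hzv hf.le
    have h1 := h f hfv
    rw [← valued_algebraMap v] at h1
    have hyx : y = z * x := by rw [hz]; field_simp
    have e : algebraMap F _ a * x ^ 2 + algebraMap F _ w * x * y + algebraMap F _ b * y ^ 2 =
      (algebraMap F _ (a + w * f + b * f ^ 2) + (z - algebraMap F _ f) *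
        (algebraMap F _ w + algebraMap F _ b * (z + algebraMap F _ f))) * x ^ 2 := by
      rw [hyx]; push_cast; ring
    rw [e, map_mul, map_pow, Valuation.map_add_eq_of_lt_left, h1, one_mul]
    rw [h1, map_mul]
    have : Valued.v (algebraMap F (v.adicCompletion F) w + algebraMap F _ b *
        (z + algebraMap F _ f)) ≤ 1 := by
      refine Valuation.map_add_le _ (by rwa [valued_algebraMap]) ?_
      rw [map_mul, valued_algebraMap]
      exact mul_le_one' hb (Valuation.map_add_le _ hzv (by rwa [valued_algebraMap]))
    exact (mul_le_mul' le_rfl this).trans_lt (by rwa [mul_one])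
  have hle : ∀ x y, v.valuation F x ≤ 1 → v.valuation F y ≤ 1 →
      v.valuation F (a * x ^ 2 + w * x * y + b * y ^ 2) ≤ 1 := fun x y hx hy => by
    refine Valuation.map_add_le _ (Valuation.map_add_le _ ?_ ?_) ?_ <;>
      simp only [map_mul, map_pow]
    exacts [mul_le_one' ha (pow_le_one' hx 2), mul_le_one' (mul_le_one' hw hx) hy,
      mul_le_one' hb (pow_le_one' hy 2)]
  rcases le_total (Valued.v y) (Valued.v x) with hxy | hxy
  · rw [max_eq_left hxy]
    refine key a b ha hb (fun z hz => ?_) x y hxy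
    refine le_antisymm (by simpa using hle 1 z (by simp) hz) (not_lt.mp fun hlt => ?_)
    have := (h 1 z (by simp) hz (by simpa using hlt)).1
    simp at this
  · rw [max_eq_right hxy, ← key b a hb ha (fun z hz => ?_) y x hxy]
    · congr 1; ring
    have e : a * z ^ 2 + w * z * 1 + b * 1 ^ 2 = b + w * z + a * z ^ 2 := by ring
    refine le_antisymm (e ▸ hle z 1 hz (by simp)) (not_lt.mp fun hlt => ?_)
    have := (h z 1 hz (by simp) (by rwa [e])).2
    simp at this

end Completion

end

section

/-- Three elements of an algebra satisfying the Clifford relations of the ternary quadratic form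
`a x² + b y² + c z² + u y z + v x z + w x y`. -/
structure IsCliffordTriple {F A : Type*} [CommRing F] [Ring A] [Algebra F A] (x y z : A)
    (a b c u v w : F) : Prop where
  hxx : x * x = a • (1 : A)
  hyy : y * y = b • (1 : A)
  hzz : z * z = c • (1 : A)
  hyx : y * x = w • (1 : A) - x * y
  hzx : z * x = v • (1 : A) - x * z
  hzy : z * y = u • (1 : A) - y * z

namespace IsCliffordTriple

variable {F A : Type*} [CommRing F] [Ring A] [Algebra F A] {x y z : A} {a b c u v w : F}

theorem reassoc {x y r : A} (h : x * y = r) (s : A) : x * (y * s) = r * s := by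
  rw [← mul_assoc, h]

section Span

variable (O : Subring F)

variable (x y z) in
/-- The span of the sorted monomials of even degree. -/
def evenSpan : Submodule O A := Submodule.span O {1, x * y, x * z, y * z}

variable (x y z) in
/-- The span of the sorted monomials of odd degree. -/
def oddSpan : Submodule O A := Submodule.span O {x, y, z, x * (y * z)}

theorem exists_of_mem_evenSpan {m : A} (hm : m ∈ evenSpan x y z O) :
    ∃ t α β γ : O, m = (t : F) • (1 : A) + (α : F) • (x * y) + (β : F) • (x * z) +
      (γ : F) • (y * z) := by
  simp only [evenSpan, Submodule.mem_span_insert, Submodule.mem_span_singleton] at hm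
  obtain ⟨t, _, ⟨α, _, ⟨β, _, ⟨γ, rfl⟩, rfl⟩, rfl⟩, rfl⟩ := hm
  exact ⟨t, α, β, γ, by simp only [Subring.smul_def]; abel⟩

variable {O}

theorem mul_mem_oddSpan (h : IsCliffordTriple x y z a b c u v w) (ha : a ∈ O) (hb : b ∈ O)
    (hc : c ∈ O) (hu : u ∈ O) (hv : v ∈ O) (hw : w ∈ O) {m : A} (hm : m ∈ evenSpan x y z O) :
    x * m ∈ oddSpan x y z O ∧ y * m ∈ oddSpan x y z O ∧ z * m ∈ oddSpan x y z O := by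
  have hs : ∀ {r : F} {m : A}, r ∈ O → m ∈ oddSpan x y z O → r • m ∈ oddSpan x y z O :=
    fun {r m} hr hm => Submodule.smul_mem _ (⟨r, hr⟩ : O) hm
  have hX : x ∈ oddSpan x y z O := Submodule.subset_span (by simp)
  have hY : y ∈ oddSpan x y z O := Submodule.subset_span (by simp)
  have hZ : z ∈ oddSpan x y z O := Submodule.subset_span (by simp)
  have hT : x * (y * z) ∈ oddSpan x y z O := Submodule.subset_span (by simp)
  induction hm using Submodule.span_induction with
  | mem m hm =>
    obtain ⟨hxx, hyy, hzz, hyx, hzx, hzy⟩ := h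
    have xx' := reassoc hxx
    have yy' := reassoc hyy
    have yx' := reassoc hyx
    have zx' := reassoc hzx
    have zy' := reassoc hzy
    rcases hm with rfl | rfl | rfl | rfl <;> refine ⟨?_, ?_, ?_⟩ <;>
    (try simp only [hyy, hzz, hzy, xx', yy', yx', zx', zy', sub_mul, mul_sub,
      smul_mul_assoc, mul_smul_comm, one_mul, mul_one, mul_assoc]) <;>
    repeat' first
      | with_reducible assumption
      | apply hs (by assumption)
      | refine sub_mem ?_ ?_
  | zero => simp
  | add p q _ _ hp hq =>
    simp only [mul_add]
    exact ⟨add_mem hp.1 hq.1, add_mem hp.2.1 hq.2.1, add_mem hp.2.2 hq.2.2⟩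
  | smul r p _ hp =>
    simp only [mul_smul_comm]
    exact ⟨Submodule.smul_mem _ _ hp.1, Submodule.smul_mem _ _ hp.2.1,
      Submodule.smul_mem _ _ hp.2.2⟩

theorem mul_mem_evenSpan (h : IsCliffordTriple x y z a b c u v w) (ha : a ∈ O) (hb : b ∈ O)
    (hc : c ∈ O) (hu : u ∈ O) (hv : v ∈ O) (hw : w ∈ O) {m : A} (hm : m ∈ oddSpan x y z O) :
    x * m ∈ evenSpan x y z O ∧ y * m ∈ evenSpan x y z O ∧ z * m ∈ evenSpan x y z O := by
  have hs : ∀ {r : F} {m : A}, r ∈ O → m ∈ evenSpan x y z O → r • m ∈ evenSpan x y z O :=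
    fun {r m} hr hm => Submodule.smul_mem _ (⟨r, hr⟩ : O) hm
  have h1 : 1 ∈ evenSpan x y z O := Submodule.subset_span (by simp)
  have hX : x * y ∈ evenSpan x y z O := Submodule.subset_span (by simp)
  have hY : x * z ∈ evenSpan x y z O := Submodule.subset_span (by simp)
  have hZ : y * z ∈ evenSpan x y z O := Submodule.subset_span (by simp)
  induction hm using Submodule.span_induction with
  | mem m hm =>
    obtain ⟨hxx, hyy, hzz, hyx, hzx, hzy⟩ := h
    have xx' := reassoc hxx
    have yy' := reassoc hyy
    have yx' := reassoc hyx
    have zx' := reassoc hzx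
    have zy' := reassoc hzy
    rcases hm with rfl | rfl | rfl | rfl <;> refine ⟨?_, ?_, ?_⟩ <;>
    (try simp only [hxx, hyy, hzz, hyx, hzx, hzy, xx', yy', yx', zx', zy', sub_mul, mul_sub,
      smul_mul_assoc, mul_smul_comm, one_mul, mul_one, mul_assoc]) <;>
    repeat' first
      | with_reducible assumption
      | apply hs (by assumption)
      | refine sub_mem ?_ ?_
  | zero => simp
  | add p q _ _ hp hq =>
    simp only [mul_add]
    exact ⟨add_mem hp.1 hq.1, add_mem hp.2.1 hq.2.1, add_mem hp.2.2 hq.2.2⟩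
  | smul r p _ hp =>
    simp only [mul_smul_comm]
    exact ⟨Submodule.smul_mem _ _ hp.1, Submodule.smul_mem _ _ hp.2.1,
      Submodule.smul_mem _ _ hp.2.2⟩

end Span

/-- Elements of the even part with non-zero norm are invertible. -/
theorem isUnit_of_norm {F B : Type*} [Field F] [Ring B] [Algebra F B]
    {X Y Z : B} {a b c u v w : F}
    (hXX : X * X = w • X - (a * b) • (1 : B)) (hYY : Y * Y = v • Y - (a * c) • (1 : B))
    (hZZ : Z * Z = u • Z - (b * c) • (1 : B))
    (hXY : X * Y + Y * X = w • Y + v • X - (a * u) • (1 : B))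
    (hXZ : X * Z + Z * X = u • X + w • Z - (w * u - v * b) • (1 : B))
    (hYZ : Y * Z + Z * Y = u • Y + v • Z - (c * w) • (1 : B)) (t α β γ : F)
    (hN : t ^ 2 + a * b * α ^ 2 + a * c * β ^ 2 + b * c * γ ^ 2 + t * (w * α + v * β + u * γ) +
      u * a * α * β + (u * w - b * v) * α * γ + c * w * β * γ ≠ 0) :
    IsUnit (t • (1 : B) + α • X + β • Y + γ • Z) := by
  set N := t ^ 2 + a * b * α ^ 2 + a * c * β ^ 2 + b * c * γ ^ 2 + t * (w * α + v * β + u * γ) +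
      u * a * α * β + (u * w - b * v) * α * γ + c * w * β * γ with hNdef
  set e := t • (1 : B) + α • X + β • Y + γ • Z with he
  set s := 2 * t + w * α + v * β + u * γ with hs
  have hsq : e * e = s • e - N • (1 : B) := by
    have : e * e = (t * t) • (1 : B) + (2 * t * α) • X + (2 * t * β) • Y + (2 * t * γ) • Z +
        (α * α) • (X * X) + (β * β) • (Y * Y) + (γ * γ) • (Z * Z) +
        (α * β) • (X * Y + Y * X) + (α * γ) • (X * Z + Z * X) + (β * γ) • (Y * Z + Z * Y) := by
      rw [he]
      simp only [add_mul, mul_add, smul_mul_assoc, mul_smul_comm, one_mul, mul_one]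
      module
    rw [this, hXX, hYY, hZZ, hXY, hXZ, hYZ, he, hs, hNdef]
    module
  have h1 : e * (N⁻¹ • (s • (1 : B) - e)) = 1 := by
    rw [mul_smul_comm, mul_sub, mul_smul_comm, mul_one, hsq, sub_sub_cancel, smul_smul,
      inv_mul_cancel₀ hN, one_smul]
  have h2 : (N⁻¹ • (s • (1 : B) - e)) * e = 1 := by
    rw [smul_mul_assoc, sub_mul, smul_mul_assoc, one_mul, hsq, sub_sub_cancel, smul_smul,
      inv_mul_cancel₀ hN, one_smul]
  exact ⟨⟨e, _, h1, h2⟩, rfl⟩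

theorem even_relations (h : IsCliffordTriple x y z a b c u v w) :
    (x * y) * (x * y) = w • (x * y) - (a * b) • (1 : A) ∧
    (x * z) * (x * z) = v • (x * z) - (a * c) • (1 : A) ∧
    (y * z) * (y * z) = u • (y * z) - (b * c) • (1 : A) ∧
    (x * y) * (x * z) + (x * z) * (x * y) = w • (x * z) + v • (x * y) - (a * u) • (1 : A) ∧
    (x * y) * (y * z) + (y * z) * (x * y) =
      u • (x * y) + w • (y * z) - (w * u - v * b) • (1 : A) ∧
    (x * z) * (y * z) + (y * z) * (x * z) = u • (x * z) + v • (y * z) - (c * w) • (1 : A) := by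
  obtain ⟨hxx, hyy, hzz, hyx, hzx, hzy⟩ := h
  have xx' := reassoc hxx
  have yy' := reassoc hyy
  have yx' := reassoc hyx
  have zx' := reassoc hzx
  have zy' := reassoc hzy
  refine ⟨?_, ?_, ?_, ?_, ?_, ?_⟩ <;>
    simp only [hxx, hyy, hzz, hyx, hzy, xx', yy', yx', zx', zy', sub_mul, mul_sub,
      smul_mul_assoc, mul_smul_comm, one_mul, mul_one, mul_assoc] <;> module

end IsCliffordTriple

end

section

open Paper IsCliffordTriple

namespace CliffordAlgebra

variable {F W : Type*} [Field F] [AddCommGroup W] [Module F W] {ψ : LinearMap.BilinForm F W}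

theorem isCliffordTriple_ι (hψ : ψ.IsSymm) (e : Fin 3 → W) :
    IsCliffordTriple (ι (LinearMap.BilinMap.toQuadraticMap ψ) (e 0))
      (ι (LinearMap.BilinMap.toQuadraticMap ψ) (e 1))
      (ι (LinearMap.BilinMap.toQuadraticMap ψ) (e 2))
      (ψ (e 0) (e 0)) (ψ (e 1) (e 1)) (ψ (e 2) (e 2)) (2 * ψ (e 1) (e 2)) (2 * ψ (e 0) (e 2))
      (2 * ψ (e 0) (e 1)) := by
  have hsq : ∀ x, ι (LinearMap.BilinMap.toQuadraticMap ψ) x *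
      ι (LinearMap.BilinMap.toQuadraticMap ψ) x = ψ x x • 1 := fun x => by
    rw [ι_sq_scalar, Algebra.algebraMap_eq_smul_one]; rfl
  have hsw : ∀ x y, ι (LinearMap.BilinMap.toQuadraticMap ψ) y *
      ι (LinearMap.BilinMap.toQuadraticMap ψ) x = (2 * ψ x y) • 1 -
      ι (LinearMap.BilinMap.toQuadraticMap ψ) x * ι (LinearMap.BilinMap.toQuadraticMap ψ) y :=
    fun x y => by
      rw [eq_sub_iff_add_eq, ι_mul_ι_add_swap, Algebra.algebraMap_eq_smul_one]
      congr 1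
      simp only [QuadraticMap.polar, LinearMap.BilinMap.toQuadraticMap_apply, map_add,
        LinearMap.add_apply]
      have hs : ψ y x = ψ x y := hψ.eq y x
      rw [hs]
      ring
  exact ⟨hsq _, hsq _, hsq _, hsw _ _, hsw _ _, hsw _ _⟩

theorem mem_evenSpan_of_mem_APlus {R : Type*} [CommRing R] [Algebra R F] [Module R W]
    [IsScalarTower R F W] (hψ : ψ.IsSymm) (e : Fin 3 → W) {O : Subring F}
    (hR : ∀ r, algebraMap R F r ∈ O) (hd : ∀ i, ψ (e i) (e i) ∈ O)
    (hp : ∀ i j, 2 * ψ (e i) (e j) ∈ O) (N : Submodule R W)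
    (hN : ∀ n ∈ N, ∃ c : Fin 3 → F, (∀ i, c i ∈ O) ∧ n = ∑ i, c i • e i)
    {y : CliffordAlgebra (LinearMap.BilinMap.toQuadraticMap ψ)}
    (hy : y ∈ APlus R F W (LinearMap.BilinMap.toQuadraticMap ψ) N) :
    y ∈ evenSpan (ι (LinearMap.BilinMap.toQuadraticMap ψ) (e 0))
      (ι (LinearMap.BilinMap.toQuadraticMap ψ) (e 1))
      (ι (LinearMap.BilinMap.toQuadraticMap ψ) (e 2)) O := by
  have h := isCliffordTriple_ι hψ e
  set x := ι (LinearMap.BilinMap.toQuadraticMap ψ) with hx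
  obtain ⟨hye, hyN⟩ := hy
  have key : ∀ s ∈ evenSpan (x (e 0)) (x (e 1)) (x (e 2)) O ⊔
      oddSpan (x (e 0)) (x (e 1)) (x (e 2)) O,
      y * s ∈ evenSpan (x (e 0)) (x (e 1)) (x (e 2)) O ⊔
      oddSpan (x (e 0)) (x (e 1)) (x (e 2)) O := by
    clear hye
    induction hyN using Algebra.adjoin_induction with
    | mem y hy =>
      obtain ⟨n, hn, rfl⟩ := hy
      obtain ⟨c, hc, rfl⟩ := hN n hn
      intro s hs
      rw [map_sum, Finset.sum_mul]
      refine sum_mem fun i _ => ?_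
      rw [map_smul, smul_mul_assoc]
      refine Submodule.smul_mem _ (⟨c i, hc i⟩ : O) ?_
      obtain ⟨s0, hs0, s1, hs1, rfl⟩ := Submodule.mem_sup.mp hs
      obtain ⟨h0, h1, h2⟩ := h.mul_mem_oddSpan (hd _) (hd _) (hd _) (hp _ _) (hp _ _) (hp _ _) hs0
      obtain ⟨g0, g1, g2⟩ := h.mul_mem_evenSpan (hd _) (hd _) (hd _) (hp _ _) (hp _ _) (hp _ _) hs1
      rw [mul_add]
      fin_cases i
      · exact add_mem (Submodule.mem_sup_right h0) (Submodule.mem_sup_left g0)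
      · exact add_mem (Submodule.mem_sup_right h1) (Submodule.mem_sup_left g1)
      · exact add_mem (Submodule.mem_sup_right h2) (Submodule.mem_sup_left g2)
    | algebraMap r =>
      intro s hs
      rw [IsScalarTower.algebraMap_apply R F, ← Algebra.smul_def]
      exact Submodule.smul_mem _ (⟨_, hR r⟩ : O) hs
    | add p q _ _ hp hq =>
      intro s hs
      rw [add_mul]
      exact add_mem (hp s hs) (hq s hs)
    | mul p q _ _ hp hq =>
      intro s hs
      rw [mul_assoc]
      exact hp _ (hq s hs)
  have h1 := key 1 (Submodule.mem_sup_left (Submodule.subset_span (by simp)))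
  rw [mul_one] at h1
  obtain ⟨s0, hs0, s1, hs1, hs⟩ := Submodule.mem_sup.mp h1
  have he2 : ∀ i j, x (e i) * x (e j) ∈ evenOdd (LinearMap.BilinMap.toQuadraticMap ψ) 0 :=
    fun i j => ι_mul_ι_mem_evenOdd_zero _ _ _
  have he1 : ∀ i, x (e i) ∈ evenOdd (LinearMap.BilinMap.toQuadraticMap ψ) 1 :=
    fun i => ι_mem_evenOdd_one _ _
  have e0 : s0 ∈ evenOdd (LinearMap.BilinMap.toQuadraticMap ψ) 0 := by
    refine (Submodule.span_le (p := (evenOdd (LinearMap.BilinMap.toQuadraticMap ψ)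
      0).restrictScalars O)).mpr ?_ hs0
    rintro m (rfl | rfl | rfl | rfl)
    exacts [one_le_evenOdd_zero _ (Submodule.one_le.mp le_rfl), he2 _ _, he2 _ _, he2 _ _]
  have e1 : s1 ∈ evenOdd (LinearMap.BilinMap.toQuadraticMap ψ) 1 := by
    refine (Submodule.span_le (p := (evenOdd (LinearMap.BilinMap.toQuadraticMap ψ)
      1).restrictScalars O)).mpr ?_ hs1
    rintro m (rfl | rfl | rfl | rfl)
    · exact he1 _
    · exact he1 _
    · exact he1 _
    · have := SetLike.mul_mem_graded (A := evenOdd (LinearMap.BilinMap.toQuadraticMap ψ))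
        (he1 0) (he2 1 2)
      simpa using this
  have hs1' : s1 = 0 := by
    have hye' : y ∈ evenOdd (LinearMap.BilinMap.toQuadraticMap ψ) 0 := hye
    have : s1 ∈ evenOdd (LinearMap.BilinMap.toQuadraticMap ψ) 0 := by
      rw [← eq_sub_iff_add_eq'] at hs
      rw [hs]
      exact sub_mem hye' e0
    exact (Submodule.disjoint_def.mp
      (evenOdd_isCompl (LinearMap.BilinMap.toQuadraticMap ψ)).disjoint) _ this e1
  rw [← hs, hs1', add_zero]
  exact hs0

theorem exists_of_mem_even (hψ : ψ.IsSymm) (e : Module.Basis (Fin 3) F W)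
    {y : CliffordAlgebra (LinearMap.BilinMap.toQuadraticMap ψ)}
    (hy : y ∈ CliffordAlgebra.even (LinearMap.BilinMap.toQuadraticMap ψ)) :
    ∃ t α β γ : F, y = t • 1 + α • (ι _ (e 0) * ι _ (e 1)) + β • (ι _ (e 0) * ι _ (e 2)) +
      γ • (ι _ (e 1) * ι _ (e 2)) := by
  have h := mem_evenSpan_of_mem_APlus (R := F) hψ e (O := ⊤) (by simp) (by simp) (by simp) ⊤
    (fun n _ => ⟨fun i => e.repr n i, by simp, (e.sum_repr n).symm⟩) (y := y) ⟨hy, by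
      have : cliffordOrder F F W (LinearMap.BilinMap.toQuadraticMap ψ) ⊤ = ⊤ := by
        rw [cliffordOrder, ← adjoin_range_ι]; simp
      show y ∈ cliffordOrder F F W (LinearMap.BilinMap.toQuadraticMap ψ) ⊤
      rw [this]; trivial⟩
  obtain ⟨t, α, β, γ, h⟩ := exists_of_mem_evenSpan _ h
  exact ⟨t, α, β, γ, h⟩

section Orthogonal

variable (k : Module.Basis (Fin 3) F W)

/-- The product of the vectors of a basis. -/
def xi (ψ : LinearMap.BilinForm F W) (k : Fin 3 → W) :
    CliffordAlgebra (LinearMap.BilinMap.toQuadraticMap ψ) :=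
  ι _ (k 0) * ι _ (k 1) * ι _ (k 2)

theorem isCliffordTriple_of_orthogonal (hψ : ψ.IsSymm) (horth : ∀ i j, i ≠ j → ψ (k i) (k j) = 0) :
    IsCliffordTriple (ι (LinearMap.BilinMap.toQuadraticMap ψ) (k 0))
      (ι (LinearMap.BilinMap.toQuadraticMap ψ) (k 1))
      (ι (LinearMap.BilinMap.toQuadraticMap ψ) (k 2))
      (ψ (k 0) (k 0)) (ψ (k 1) (k 1)) (ψ (k 2) (k 2)) 0 0 0 := by
  have := isCliffordTriple_ι hψ k
  rwa [horth 1 2 (by decide), horth 0 2 (by decide), horth 0 1 (by decide), mul_zero] at this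

theorem ι_mul_xi_mem_even (m : W) :
    ι _ m * xi ψ k ∈ CliffordAlgebra.even (LinearMap.BilinMap.toQuadraticMap ψ) := by
  have : ι _ m * xi ψ k = (ι _ m * ι _ (k 0)) * (ι _ (k 1) * ι _ (k 2)) := by
    simp [xi, mul_assoc]
  rw [this]
  exact mul_mem (ι_mul_ι_mem_evenOdd_zero _ _ _) (ι_mul_ι_mem_evenOdd_zero _ _ _)

variable (hψ : ψ.IsSymm) (horth : ∀ i j, i ≠ j → ψ (k i) (k j) = 0)

include hψ horth

theorem orthogonal_relations {x y z : CliffordAlgebra (LinearMap.BilinMap.toQuadraticMap ψ)}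
    (hx : x = ι _ (k 0)) (hy : y = ι _ (k 1)) (hz : z = ι _ (k 2)) :
    (x * x = ψ (k 0) (k 0) • 1 ∧ y * y = ψ (k 1) (k 1) • 1 ∧ z * z = ψ (k 2) (k 2) • 1) ∧
    (y * x = -(x * y) ∧ z * x = -(x * z) ∧ z * y = -(y * z)) ∧
    (∀ s, x * (x * s) = ψ (k 0) (k 0) • s) ∧ (∀ s, y * (y * s) = ψ (k 1) (k 1) • s) ∧
    (∀ s, z * (z * s) = ψ (k 2) (k 2) • s) ∧
    (∀ s, y * (x * s) = -(x * (y * s))) ∧ (∀ s, z * (x * s) = -(x * (z * s))) ∧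
    (∀ s, z * (y * s) = -(y * (z * s))) := by
  subst hx hy hz
  obtain ⟨hxx, hyy, hzz, hyx, hzx, hzy⟩ := isCliffordTriple_of_orthogonal k hψ horth
  rw [zero_smul, zero_sub] at hyx hzx hzy
  refine ⟨⟨hxx, hyy, hzz⟩, ⟨hyx, hzx, hzy⟩, ?_, ?_, ?_, ?_, ?_, ?_⟩ <;> intro s <;>
    rw [← mul_assoc]
  · rw [hxx, smul_one_mul]
  · rw [hyy, smul_one_mul]
  · rw [hzz, smul_one_mul]
  · rw [hyx, neg_mul, mul_assoc]
  · rw [hzx, neg_mul, mul_assoc]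
  · rw [hzy, neg_mul, mul_assoc]

theorem xi_mul_xi : xi ψ k * xi ψ k =
    (-(ψ (k 0) (k 0) * ψ (k 1) (k 1) * ψ (k 2) (k 2))) • 1 := by
  obtain ⟨⟨hxx, hyy, hzz⟩, ⟨hyx, hzx, hzy⟩, hxx', hyy', hzz', hyx', hzx', hzy'⟩ :=
    orthogonal_relations k hψ horth rfl rfl rfl
  simp only [xi, mul_assoc, hyx', hzx', hzy', hxx, hyy, hzz, mul_neg, neg_neg,
    mul_smul_comm, mul_one, neg_smul, smul_neg, smul_smul]
  congr 2; ring

theorem ι_mul_xi (m : W) : ι _ m * xi ψ k = xi ψ k * ι _ m := by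
  obtain ⟨⟨hxx, hyy, hzz⟩, ⟨hyx, hzx, hzy⟩, hxx', hyy', hzz', hyx', hzx', hzy'⟩ :=
    orthogonal_relations k hψ horth rfl rfl rfl
  have : (LinearMap.mulRight F (xi ψ k)).comp (ι (LinearMap.BilinMap.toQuadraticMap ψ)) =
      (LinearMap.mulLeft F (xi ψ k)).comp (ι (LinearMap.BilinMap.toQuadraticMap ψ)) := by
    refine k.ext fun i => ?_
    fin_cases i <;> simp only [LinearMap.comp_apply, LinearMap.mulRight_apply,
      LinearMap.mulLeft_apply] <;>
    simp [xi, mul_assoc, hyx', hzx', hzy', hxx', hyy', hzx, hzy, hzz]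
  exact LinearMap.congr_fun this m

theorem reverse_xi : reverse (xi ψ k) = - xi ψ k := by
  obtain ⟨⟨hxx, hyy, hzz⟩, ⟨hyx, hzx, hzy⟩, hxx', hyy', hzz', hyx', hzx', hzy'⟩ :=
    orthogonal_relations k hψ horth rfl rfl rfl
  simp [xi, reverse.map_mul, reverse_ι, hyx', hzx, hzy, mul_assoc]

theorem reverse_ι_mul_xi (m : W) : reverse (ι _ m * xi ψ k) = - (ι _ m * xi ψ k) := by
  rw [reverse.map_mul, reverse_xi k hψ horth, reverse_ι, neg_mul, ι_mul_xi k hψ horth]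

theorem exists_ι_mul_xi [CharZero F] (hk : ∀ i, ψ (k i) (k i) ≠ 0)
    {y : CliffordAlgebra (LinearMap.BilinMap.toQuadraticMap ψ)}
    (hy : y ∈ CliffordAlgebra.even (LinearMap.BilinMap.toQuadraticMap ψ))
    (hy' : reverse y = - y) : ∃ m : W, y = ι _ m * xi ψ k := by
  obtain ⟨t, α, β, γ, rfl⟩ := exists_of_mem_even hψ k hy
  obtain ⟨⟨hxx, hyy, hzz⟩, ⟨hyx, hzx, hzy⟩, hxx', hyy', hzz', hyx', hzx', hzy'⟩ :=
    orthogonal_relations k hψ horth rfl rfl rfl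
  simp only [map_add, map_smul, reverse.map_mul, reverse_ι, reverse.map_one, hyx, hzx, hzy,
    smul_neg] at hy'
  have ht : (2 * t) • (1 : CliffordAlgebra (LinearMap.BilinMap.toQuadraticMap ψ)) = 0 := by
    rw [← sub_eq_zero] at hy'
    rw [← hy']; module
  have ht' : t • (1 : CliffordAlgebra (LinearMap.BilinMap.toQuadraticMap ψ)) = 0 := by
    rw [mul_smul] at ht
    exact (smul_eq_zero.mp ht).resolve_left two_ne_zero
  refine ⟨(γ * (ψ (k 0) (k 0))⁻¹) • k 0 + (-β * (ψ (k 1) (k 1))⁻¹) • k 1 +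
    (α * (ψ (k 2) (k 2))⁻¹) • k 2, ?_⟩
  simp only [xi, map_add, map_smul, add_mul, smul_mul_assoc, mul_assoc, hyx', hzx', hzy', hxx',
    hyy', hzz, ht', mul_neg, mul_smul_comm, mul_one, smul_smul, smul_neg, inv_mul_cancel₀ (hk _),
    neg_mul, neg_smul, map_neg, neg_neg]
  module

theorem ι_mul_ι_mul_ι_sub (m x y : W) :
    ι (LinearMap.BilinMap.toQuadraticMap ψ) m * ι _ y * ι _ x - ι _ x * ι _ y * ι _ m =
      (-2 * k.det ![m, x, y]) • xi ψ k := by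
  obtain ⟨⟨hxx, hyy, hzz⟩, ⟨hyx, hzx, hzy⟩, hxx', hyy', hzz', hyx', hzx', hzy'⟩ :=
    orthogonal_relations k hψ horth rfl rfl rfl
  let P : MultilinearMap F (fun _ : Fin 3 => W)
      (CliffordAlgebra (LinearMap.BilinMap.toQuadraticMap ψ)) :=
    (MultilinearMap.mkPiAlgebraFin F 3 _).compLinearMap
      fun _ => ι (LinearMap.BilinMap.toQuadraticMap ψ)
  have hP : ∀ g : Fin 3 → W, P g = ι _ (g 0) * ι _ (g 1) * ι _ (g 2) := fun g => by
    simp [P, MultilinearMap.mkPiAlgebraFin_apply, List.ofFn_succ, mul_assoc]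
  let G : MultilinearMap F (fun _ : Fin 3 => W)
      (CliffordAlgebra (LinearMap.BilinMap.toQuadraticMap ψ)) :=
    P.domDomCongr (Equiv.swap 1 2) - P.domDomCongr (Equiv.swap 0 1 * Equiv.swap 1 2)
  have hG : ∀ g : Fin 3 → W, G g = ι _ (g 0) * ι _ (g 2) * ι _ (g 1) -
      ι _ (g 1) * ι _ (g 2) * ι _ (g 0) := fun g => by
    simp only [G, _root_.sub_apply, MultilinearMap.domDomCongr_apply, hP]
    rfl
  have hcomm : ∀ p q : W, ι (LinearMap.BilinMap.toQuadraticMap ψ) p * (ι _ q * ι _ q) =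
      (ι _ q * ι _ q) * ι _ p := fun p q => by
    rw [ι_sq_scalar, Algebra.commutes]
  let A : W [⋀^Fin 3]→ₗ[F] (CliffordAlgebra (LinearMap.BilinMap.toQuadraticMap ψ)) :=
    { G with
      map_eq_zero_of_eq' := by
        intro g i j hij hne
        show G g = 0
        rw [hG]
        fin_cases i <;> fin_cases j <;> first | exact absurd rfl hne | skip
        all_goals
          simp only [Fin.zero_eta, Fin.mk_one, Fin.reduceFinMk, Fin.isValue] at hij
          simp only [hij, sub_self]
        all_goals
          first
          | rw [mul_assoc, hcomm, sub_self]
          | rw [mul_assoc (ι _ (g 1)), hcomm, sub_self] }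
  have hA : A = (LinearMap.toSpanSingleton F _ ((-2 : F) • xi ψ k)).compAlternatingMap k.det := by
    refine Module.Basis.ext_alternating k fun g hg => ?_
    obtain ⟨σ, rfl⟩ : ∃ σ : Equiv.Perm (Fin 3), g = σ :=
      ⟨Equiv.ofBijective g (Finite.injective_iff_bijective.mp hg), rfl⟩
    have h1 : (fun i => k (σ i)) = k ∘ σ := rfl
    rw [h1, AlternatingMap.map_perm, AlternatingMap.map_perm]
    congr 1
    show G k = _
    rw [hG]
    simp only [LinearMap.compAlternatingMap_apply, Module.Basis.det_self,
      LinearMap.toSpanSingleton_apply, one_smul, xi, mul_assoc, hyx', hzx, hzy, mul_neg, neg_neg]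
    module
  have := congrArg (fun f => f ![m, x, y]) hA
  calc _ = G ![m, x, y] := (hG _).symm
    _ = A ![m, x, y] := rfl
    _ = _ := by
      rw [hA]
      simp [smul_smul, mul_comm]

end Orthogonal
end CliffordAlgebra

end

section

open Paper IsDedekindDomain

namespace IsDedekindDomain.HeightOneSpectrum

variable {R F : Type*} [CommRing R] [IsDedekindDomain R] [Field F] [Algebra R F]
  [IsFractionRing R F]

theorem valuation_eq_one_of_notMem (v : HeightOneSpectrum R) {s : R} (hs : s ∉ v.asIdeal) :
    v.valuation F (algebraMap R F s) = 1 :=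
  le_antisymm (v.valuation_le_one s)
    (not_lt.mp fun h => hs ((v.valuation_lt_one_iff_mem s).mp h))

/-- `γ` is the largest value taken by `v` on `S`, i.e. the value of the generator of the localization
of `S` at `v`. -/
def IsLocalValue (v : HeightOneSpectrum R) (S : Submodule R F) (γ : WithZero (Multiplicative ℤ)) :
    Prop :=
  (∀ x ∈ S, v.valuation F x ≤ γ) ∧ ∃ x ∈ S, v.valuation F x = γ

variable {v : HeightOneSpectrum R}

theorem IsLocalValue.mul {S T : Submodule R F} {γ δ : WithZero (Multiplicative ℤ)}
    (hS : v.IsLocalValue S γ) (hT : v.IsLocalValue T δ) : v.IsLocalValue (S * T) (γ * δ) := by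
  refine ⟨fun x hx => ?_, ?_⟩
  · induction hx using Submodule.mul_induction_on' with
    | mem_mul_mem m hm n hn => rw [map_mul]; exact mul_le_mul' (hS.1 m hm) (hT.1 n hn)
    | add x _ y _ hx hy => exact (v.valuation F).map_add_le hx hy
  · obtain ⟨s, hs, rfl⟩ := hS.2
    obtain ⟨t, ht, rfl⟩ := hT.2
    exact ⟨s * t, Submodule.mul_mem_mul hs ht, map_mul _ _ _⟩

theorem IsLocalValue.unique {S : Submodule R F} {γ δ : WithZero (Multiplicative ℤ)}
    (hS : v.IsLocalValue S γ) (hT : v.IsLocalValue S δ) : γ = δ := by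
  obtain ⟨s, hs, rfl⟩ := hS.2
  obtain ⟨t, ht, rfl⟩ := hT.2
  exact le_antisymm (hT.1 s hs) (hS.1 t ht)

variable (v) in
theorem isLocalValue_span_singleton (x : F) :
    v.IsLocalValue (Submodule.span R {x}) (v.valuation F x) := by
  refine ⟨fun y hy => ?_, x, Submodule.mem_span_singleton_self x, rfl⟩
  obtain ⟨r, rfl⟩ := Submodule.mem_span_singleton.mp hy
  rw [Algebra.smul_def, map_mul]
  exact mul_le_of_le_one_left' (v.valuation_le_one r)

variable (v) in
theorem exists_isLocalValue {S : Submodule R F} (hS : S.FG) : ∃ γ, v.IsLocalValue S γ := by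
  induction S, hS using Submodule.fg_induction with
  | singleton x => exact ⟨_, v.isLocalValue_span_singleton x⟩
  | sup S T _ _ hS hT =>
    obtain ⟨γ, h1, x, hx, hxγ⟩ := hS
    obtain ⟨δ, h2, y, hy, hyδ⟩ := hT
    refine ⟨max γ δ, fun z hz => ?_, ?_⟩
    · obtain ⟨s, hs, t, ht, rfl⟩ := Submodule.mem_sup.mp hz
      exact (v.valuation F).map_add_le ((h1 s hs).trans (le_max_left _ _))
        ((h2 t ht).trans (le_max_right _ _))
    · rcases max_choice γ δ with h | h <;> rw [h]
      exacts [⟨x, Submodule.mem_sup_left hx, hxγ⟩, ⟨y, Submodule.mem_sup_right hy, hyδ⟩]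

theorem isLocalValue_idealToF_of_not_dvd {I : Ideal R} (h : ¬ v.asIdeal ∣ I) :
    v.IsLocalValue (idealToF R F I) 1 := by
  refine ⟨?_, ?_⟩
  · rintro _ ⟨x, _, rfl⟩
    exact v.valuation_le_one x
  · rw [Ideal.dvd_iff_le, SetLike.not_le_iff_exists] at h
    obtain ⟨x, hx, hxv⟩ := h
    exact ⟨_, ⟨x, hx, rfl⟩, v.valuation_eq_one_of_notMem hxv⟩

variable (v) in
theorem isLocalValue_idealToF_self :
    v.IsLocalValue (idealToF R F v.asIdeal) (WithZero.exp (-1)) := by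
  refine ⟨?_, ?_⟩
  · rintro _ ⟨x, hx, rfl⟩
    have := (v.valuation_lt_one_iff_mem (K := F) x).mpr hx
    rw [Algebra.linearMap_apply]
    rw [← WithZero.exp_zero] at this
    by_cases h0 : v.valuation F (algebraMap R F x) = 0
    · rw [h0]; exact zero_le
    · rw [← WithZero.exp_log h0, WithZero.exp_lt_exp] at this
      rw [← WithZero.exp_log h0, WithZero.exp_le_exp]
      lia
  · obtain ⟨π, hπ⟩ := v.intValuation_exists_uniformizer
    refine ⟨_, ⟨π, ?_, rfl⟩, (v.valuation_of_algebraMap π).trans hπ⟩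
    rw [SetLike.mem_coe, ← v.intValuation_lt_one_iff_mem, hπ, ← WithZero.exp_zero,
      WithZero.exp_lt_exp]
    lia

omit [IsDedekindDomain R] [IsFractionRing R F] in
theorem idealToF_mul (I J : Ideal R) : idealToF R F (I * J) = idealToF R F I * idealToF R F J :=
  Submodule.map_mul I J (Algebra.ofId R F)

theorem isLocalValue_idealToF_of_dvd {I : Ideal R} (hI : Squarefree I) (h : v.asIdeal ∣ I) :
    v.IsLocalValue (idealToF R F I) (WithZero.exp (-1)) := by
  obtain ⟨J, rfl⟩ := h
  have hJ : ¬ v.asIdeal ∣ J := fun ⟨K, hK⟩ =>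
    v.isPrime.ne_top (Ideal.isUnit_iff.mp (hI v.asIdeal ⟨K, by rw [hK, mul_assoc]⟩))
  rw [idealToF_mul, ← mul_one (WithZero.exp (-1))]
  exact v.isLocalValue_idealToF_self.mul (isLocalValue_idealToF_of_not_dvd hJ)

theorem squarefree_finprod_asIdeal {s : Set (HeightOneSpectrum R)} (hs : s.Finite) :
    Squarefree (∏ᶠ v ∈ s, v.asIdeal) := by
  rw [finprod_mem_eq_finite_toFinset_prod _ hs]
  refine Finset.squarefree_prod_of_pairwise_isCoprime (fun v _ w _ hvw => ?_) fun v _ =>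
    (Ideal.prime_of_isPrime v.ne_bot v.isPrime).squarefree
  refine IsCoprime.isRelPrime ?_
  rw [Ideal.isCoprime_iff_sup_eq]
  exact v.isMaximal.coprime_of_ne w.isMaximal fun h => hvw (HeightOneSpectrum.ext h)

theorem dvd_finprod_asIdeal_iff {s : Set (HeightOneSpectrum R)} (hs : s.Finite) :
    v.asIdeal ∣ ∏ᶠ w ∈ s, w.asIdeal ↔ v ∈ s := by
  rw [finprod_mem_eq_finite_toFinset_prod _ hs,
    (Ideal.prime_of_isPrime v.ne_bot v.isPrime).dvd_finsetProd_iff]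
  constructor
  · rintro ⟨w, hw, hvw⟩
    rw [Ideal.dvd_iff_le] at hvw
    have := w.isMaximal.eq_of_le v.isPrime.ne_top hvw
    rwa [← HeightOneSpectrum.ext this, ← hs.mem_toFinset]
  · exact fun h => ⟨v, hs.mem_toFinset.mpr h, dvd_rfl⟩

theorem exists_algebraMap_of_forall_valuation_le_one {x : F} (h : ∀ v : HeightOneSpectrum R,
    v.valuation F x ≤ 1) : ∃ r : R, algebraMap R F r = x :=
  mem_integers_of_valuation_le_one F x h

end IsDedekindDomain.HeightOneSpectrum

namespace Paper

theorem exists_smul_mem_of_fg {R W : Type*} [CommRing R] [AddCommGroup W] [Module R W]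
    (P : Submonoid R) {N T : Submodule R W} (hN : N.FG) (h : ∀ x ∈ N, ∃ s ∈ P, s • x ∈ T) :
    ∃ s ∈ P, ∀ x ∈ N, s • x ∈ T := by
  induction N, hN using Submodule.fg_induction with
  | singleton x =>
    obtain ⟨s, hs, hx⟩ := h x (Submodule.mem_span_singleton_self x)
    refine ⟨s, hs, fun y hy => ?_⟩
    obtain ⟨r, rfl⟩ := Submodule.mem_span_singleton.mp hy
    rw [smul_comm]
    exact T.smul_mem r hx
  | sup N₁ N₂ _ _ h₁ h₂ =>
    obtain ⟨s, hs, hx⟩ := h₁ fun x hx => h x (Submodule.mem_sup_left hx)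
    obtain ⟨t, ht, hy⟩ := h₂ fun x hx => h x (Submodule.mem_sup_right hx)
    refine ⟨s * t, mul_mem hs ht, fun z hz => ?_⟩
    obtain ⟨x, hxN, y, hyN, rfl⟩ := Submodule.mem_sup.mp hz
    rw [smul_add, mul_comm, mul_smul, mul_comm, mul_smul]
    exact add_mem (T.smul_mem _ (hx x hxN)) (T.smul_mem _ (hy y hyN))

theorem mem_of_forall_exists_smul_mem {R W : Type*} [CommRing R] [IsDedekindDomain R]
    (hR : ¬ IsField R) [AddCommGroup W] [Module R W] {N : Submodule R W} {x : W}
    (h : ∀ v : HeightOneSpectrum R, ∃ s ∈ v.asIdeal.primeCompl, s • x ∈ N) : x ∈ N := by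
  let I : Ideal R := N.comap (LinearMap.toSpanSingleton R W x)
  by_contra hx
  have hI : I ≠ ⊤ := fun hI => hx (by
    have : (1 : R) ∈ I := hI ▸ Submodule.mem_top
    simpa [I] using this)
  obtain ⟨P, hP, hIP⟩ := Ideal.exists_le_maximal I hI
  obtain ⟨s, hs, hsx⟩ := h ⟨P, hP.isPrime, Ring.ne_bot_of_isMaximal_of_not_isField hP hR⟩
  exact hs (hIP (by simpa [I] using hsx))

section Lattice

variable {R F W : Type*} [CommRing R] [IsDedekindDomain R] [Field F] [Algebra R F]
  [IsFractionRing R F] [AddCommGroup W] [Module F W] [Module R W] [IsScalarTower R F W]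

variable (F) in
/-- A basis of the localization of a lattice at `v`, contained in the lattice. -/
structure IsLocalBasis (v : HeightOneSpectrum R) (N : Submodule R W)
    (e : Module.Basis (Fin 3) F W) : Prop where
  mem : ∀ i, e i ∈ N
  repr_le : ∀ n ∈ N, ∀ i, v.valuation F (e.repr n i) ≤ 1

theorem exists_isLocalBasis (hW : Module.finrank F W = 3) (v : HeightOneSpectrum R)
    {N : Submodule R W} (hN : IsLat R F W N) :
    ∃ e : Module.Basis (Fin 3) F W, IsLocalBasis F v N e := by
  obtain ⟨⟨S, rfl⟩, hspan⟩ := hN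
  rw [Submodule.span_span_of_tower] at hspan
  have : FiniteDimensional F W := Module.finite_of_finrank_pos (by omega)
  let b0 := Module.Basis.ofSpan hspan.ge
  have hb0 : Set.range b0 ⊆ S := Module.Basis.ofSpan_subset hspan.ge
  let b : Module.Basis (Fin 3) F W := b0.reindex
    (b0.indexEquiv (Module.finBasisOfFinrankEq F W hW))
  have hb : ∀ i, b i ∈ S := fun i => hb0 (by simp [b])
  have hne : Nonempty (Fin 3 → S) := ⟨fun i => ⟨b i, hb i⟩⟩
  obtain ⟨g, hg⟩ := Finite.exists_max
    fun g : Fin 3 → S => v.valuation F (b.det fun i => (g i : W))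
  have hdet : b.det (fun i => (g i : W)) ≠ 0 := by
    have := hg fun i => ⟨b i, hb i⟩
    have h1 : b.det (fun i => b i) = 1 := b.det_self
    simp only [h1, map_one] at this
    intro h0
    simp [h0] at this
  obtain ⟨hli, hsp⟩ := b.is_basis_iff_det.mpr (isUnit_iff_ne_zero.mpr hdet)
  refine ⟨Module.Basis.mk hli hsp.ge, fun i => ?_, fun n hn i => ?_⟩
  · rw [Module.Basis.mk_apply]
    exact Submodule.subset_span (g i).2
  · induction hn using Submodule.span_induction with
    | mem n hn =>
      have h := b.det_smul_mk_coord_eq_det_update hli hsp.ge i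
      have h2 := LinearMap.congr_fun h n
      have h3 := hg (Function.update g i ⟨n, hn⟩)
      have h4 : (fun j => ((Function.update g i ⟨n, hn⟩ : Fin 3 → S) j : W)) =
          Function.update (fun j => (g j : W)) i n := by
        ext j
        by_cases hj : j = i
        · subst hj; simp
        · simp [hj]
      rw [h4] at h3
      have h5 : b.det (Function.update (fun j => (g j : W)) i n) =
        b.det (fun j => (g j : W)) * (Module.Basis.mk hli hsp.ge).repr n i := h2.symm
      rw [h5, map_mul] at h3
      have h6 : v.valuation F (b.det fun j => (g j : W)) ≠ 0 := by simpa using hdet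
      exact le_of_mul_le_mul_left (by simpa using h3) (zero_lt_iff.mpr h6)
    | zero => rw [map_zero, Finsupp.zero_apply, map_zero]; exact zero_le
    | add x y _ _ hx hy =>
      rw [map_add]
      exact (v.valuation F).map_add_le hx hy
    | smul r x _ hx =>
      rw [← algebraMap_smul F r x, map_smul, Finsupp.smul_apply, smul_eq_mul, map_mul]
      exact mul_le_one' (v.valuation_le_one r) hx

theorem IsLocalBasis.exists_smul_mem {v : HeightOneSpectrum R} {N : Submodule R W}
    {e : Module.Basis (Fin 3) F W} (he : IsLocalBasis F v N e) {x : W}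
    (hx : ∀ i, v.valuation F (e.repr x i) ≤ 1) : ∃ s ∈ v.asIdeal.primeCompl, s • x ∈ N := by
  choose n d hnd using fun i => v.exists_primeCompl_mul_eq_of_integer _ (hx i)
  refine ⟨∏ i, (d i : R), prod_mem fun i _ => (d i).2, ?_⟩
  rw [← e.sum_repr x, Finset.smul_sum]
  refine sum_mem fun i _ => ?_
  rw [← Finset.mul_prod_erase _ _ (Finset.mem_univ i), mul_comm, mul_smul]
  refine N.smul_mem _ ?_
  rw [← algebraMap_smul F (d i : R), smul_smul, mul_comm, hnd, algebraMap_smul]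
  exact N.smul_mem _ (he.mem i)

theorem valuation_det_le_one (v : HeightOneSpectrum R) (A : Matrix (Fin 3) (Fin 3) F)
    (hA : ∀ i j, v.valuation F (A i j) ≤ 1) : v.valuation F A.det ≤ 1 := by
  have : A = (Matrix.of fun i j => (⟨A i j, hA i j⟩ : (v.valuation F).integer)).map
      (v.valuation F).integer.subtype := by ext; rfl
  rw [this, ← RingHom.mapMatrix_apply, ← RingHom.map_det]
  exact (Matrix.det (Matrix.of fun i j => (⟨A i j, hA i j⟩ : (v.valuation F).integer))).2

omit [IsScalarTower R F W] in
theorem IsLocalBasis.valuation_det_le_one {v : HeightOneSpectrum R} {N : Submodule R W}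
    {e : Module.Basis (Fin 3) F W} (he : IsLocalBasis F v N e) {f : Fin 3 → W}
    (hf : ∀ i, f i ∈ N) : v.valuation F (e.det f) ≤ 1 := by
  rw [Module.Basis.det_apply]
  exact Paper.valuation_det_le_one v _ fun i j => he.repr_le _ (hf j) i

theorem isLocalValue_latIdx {v : HeightOneSpectrum R} {M N : Submodule R W}
    {e f : Module.Basis (Fin 3) F W} (hM : M.FG) (he : IsLocalBasis F v M e)
    (hf : IsLocalBasis F v N f) : v.IsLocalValue (latIdx R F W M N) (v.valuation F (e.det f)) := by
  refine ⟨fun x hx => ?_, ?_⟩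
  · induction hx using Submodule.span_induction with
    | mem x hx =>
      obtain ⟨α, hα, rfl⟩ := hx
      have h1 := e.det_comp (α : W →ₗ[F] W) e
      rw [e.det_self, mul_one] at h1
      rw [← h1]
      have h3 : e.det ((α : W →ₗ[F] W) ∘ e) = e.det f * f.det ((α : W →ₗ[F] W) ∘ e) := by
        have := e.det_mul_det f (e.map α)
        have h4 : ((α : W →ₗ[F] W) ∘ e : Fin 3 → W) = e.map α := by ext; simp
        rw [h4, this]
      rw [h3, map_mul]
      exact mul_le_of_le_one_right' (hf.valuation_det_le_one fun i => hα _ (he.mem i))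
    | zero => simp
    | add x y _ _ hx hy => exact (v.valuation F).map_add_le hx hy
    | smul r x _ hx =>
      rw [Algebra.smul_def, map_mul]
      exact (mul_le_of_le_one_left' (v.valuation_le_one r)).trans hx
  · let β : W ≃ₗ[F] W := e.equiv f (Equiv.refl _)
    obtain ⟨s, hs, hsM⟩ := exists_smul_mem_of_fg v.asIdeal.primeCompl (T := N.comap
      ((β : W →ₗ[F] W).restrictScalars R)) hM fun x hx => by
        have : ∀ i, f.repr (β x) i = e.repr x i := fun i => by
          simp [β, Module.Basis.equiv]
        obtain ⟨s, hs, h⟩ := hf.exists_smul_mem (x := β x) fun i => by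
          rw [this]; exact he.repr_le x hx i
        exact ⟨s, hs, by simpa using h⟩
    have hs1 := v.valuation_eq_one_of_notMem (F := F) hs
    have hs0 : algebraMap R F s ≠ 0 := by
      intro h0; simp [h0] at hs1
    let α : W ≃ₗ[F] W := β.trans (LinearEquiv.smulOfNeZero F W _ hs0)
    refine ⟨_, Submodule.subset_span ⟨α, fun x hx => ?_, rfl⟩, ?_⟩
    · have := hsM x hx
      simpa [α] using this
    · have h1 := e.det_comp (α : W →ₗ[F] W) e
      rw [e.det_self, mul_one] at h1
      rw [← h1]
      have h2 : ((α : W →ₗ[F] W) ∘ e : Fin 3 → W) = fun i => (algebraMap R F s) • f i := by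
        ext i
        simp [α, β]
      rw [h2, e.det.map_smul_univ]
      simp [hs1]

omit [IsDedekindDomain R] in
theorem exists_smul_mem_of_isLat {M : Submodule R W} (hM : IsLat R F W M) (x : W) :
    ∃ s ∈ nonZeroDivisors R, s • x ∈ M := by
  have hx : x ∈ Submodule.span F (M : Set W) := hM.2 ▸ Submodule.mem_top
  induction hx using Submodule.span_induction with
  | mem x hx => exact ⟨1, one_mem _, by simpa using hx⟩
  | zero => exact ⟨1, one_mem _, by simp⟩
  | add x y _ _ hx hy =>
    obtain ⟨s, hs, hx⟩ := hx
    obtain ⟨t, ht, hy⟩ := hy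
    refine ⟨s * t, mul_mem hs ht, ?_⟩
    rw [smul_add, mul_comm, mul_smul, mul_comm, mul_smul]
    exact add_mem (M.smul_mem _ hx) (M.smul_mem _ hy)
  | smul a x _ hx =>
    obtain ⟨s, hs, hx⟩ := hx
    obtain ⟨⟨r, t⟩, hrt⟩ := IsLocalization.surj (nonZeroDivisors R) a
    refine ⟨t * s, mul_mem t.2 hs, ?_⟩
    have : (t * s : R) • a • x = r • s • x := by
      rw [mul_comm, mul_smul, ← algebraMap_smul F (t : R), smul_smul, mul_comm, hrt,
        algebraMap_smul, smul_comm]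
    rw [this]
    exact M.smul_mem _ hx

theorem fg_latIdx (hW : Module.finrank F W = 3) {M N : Submodule R W} (hM : IsLat R F W M)
    (hN : IsLat R F W N) : (latIdx R F W M N).FG := by
  obtain ⟨t, ht, htN⟩ := exists_smul_mem_of_fg (nonZeroDivisors R) hN.1 fun x _ =>
    exists_smul_mem_of_isLat hM x
  have ht0 : algebraMap R F t ≠ 0 := by
    simpa using nonZeroDivisors.ne_zero ht
  have hle : latIdx R F W M N ≤ Submodule.span R {((algebraMap R F t) ^ 3)⁻¹} := by
    intro x hx
    obtain ⟨r, hr⟩ := HeightOneSpectrum.exists_algebraMap_of_forall_valuation_le_one (R := R)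
      (x := algebraMap R F t ^ 3 * x) fun v => by
        obtain ⟨e, he⟩ := exists_isLocalBasis hW v hM
        obtain ⟨f, hf⟩ := exists_isLocalBasis hW v hN
        have h1 := (isLocalValue_latIdx hM.1 he hf).1 x hx
        have h2 : v.valuation F (e.det fun i => algebraMap R F t • f i) ≤ 1 :=
          he.valuation_det_le_one fun i => by
            rw [algebraMap_smul]; exact htN _ (hf.mem i)
        rw [e.det.map_smul_univ] at h2
        simp only [Finset.prod_const, Finset.card_univ, Fintype.card_fin, smul_eq_mul,
          map_mul] at h2
        rw [map_mul]
        exact (mul_le_mul_right h1 _).trans h2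
    refine Submodule.mem_span_singleton.mpr ⟨r, ?_⟩
    rw [Algebra.smul_def, hr]
    field_simp
  exact Submodule.FG.of_le (Submodule.fg_span_singleton _) hle

end Lattice
end Paper

end

section

open Paper IsCliffordTriple
open scoped TensorProduct

theorem Algebra.TensorProduct.exists_eq_smul_one_of_one_tmul {F K B : Type*} [Field F] [Field K]
    [Algebra F K] [Ring B] [Algebra F B] {α : B} {r : K} (h : (1 : K) ⊗ₜ[F] α = r ⊗ₜ[F] (1 : B)) :
    ∃ c : F, α = c • 1 := by
  by_contra hne
  have hα : α ∉ Submodule.span F {(1 : B)} := fun hα => by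
    obtain ⟨c, hc⟩ := Submodule.mem_span_singleton.mp hα
    exact hne ⟨c, hc.symm⟩
  obtain ⟨f, hf, hf1⟩ := Submodule.exists_le_ker_of_notMem hα
  have h1 : f 1 = 0 := hf1 (Submodule.mem_span_singleton_self 1)
  have h2 := congrArg (_root_.TensorProduct.rid F K ∘ LinearMap.lTensor K f) h
  simp [h1] at h2
  exact hf h2

namespace CliffordAlgebra

variable {F W : Type*} [Field F] [CharZero F] [AddCommGroup W] [Module F W]
  {ψ : LinearMap.BilinForm F W}

omit [CharZero F] in
theorem ι_mul_ι_mul_self (hψ : ψ.IsSymm) (x y : W) :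
    (ι (LinearMap.BilinMap.toQuadraticMap ψ) x * ι _ y) * (ι _ x * ι _ y) =
      (2 * ψ x y) • (ι _ x * ι _ y) - (ψ x x * ψ y y) • 1 :=
  (isCliffordTriple_ι hψ ![x, y, 0]).even_relations.1

theorem ι_mul_ι_ne_smul_one (hψ : ψ.IsSymm) {x y : W}
    (h : (2 * ψ x y) ^ 2 ≠ 4 * (ψ x x * ψ y y)) (c : F) :
    ι (LinearMap.BilinMap.toQuadraticMap ψ) x * ι _ y ≠ c • 1 := by
  intro hc
  let _ : Invertible (2 : F) := invertibleOfNonzero two_ne_zero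
  have hinj := (algebraMap F (CliffordAlgebra (LinearMap.BilinMap.toQuadraticMap ψ))).injective
  have hyx := (isCliffordTriple_ι hψ ![x, y, 0]).hyx
  have hrev := congrArg reverse hc
  simp only [map_smul, reverse.map_mul, reverse_ι, reverse.map_one] at hrev
  have h1 : (2 * ψ x y) • (1 : CliffordAlgebra (LinearMap.BilinMap.toQuadraticMap ψ)) =
      (c + c) • 1 := by
    rw [add_smul]
    nth_rw 1 [← hrev]
    rw [← hc]
    exact (sub_eq_iff_eq_add.mp hyx.symm)
  have h2 := ι_mul_ι_mul_self hψ x y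
  rw [hc] at h2
  have h3 : (c * c) • (1 : CliffordAlgebra (LinearMap.BilinMap.toQuadraticMap ψ)) =
      (2 * ψ x y * c - ψ x x * ψ y y) • 1 := by
    rw [sub_smul, mul_smul (2 * ψ x y), ← h2, smul_mul_smul_comm, one_mul]
  rw [← Algebra.algebraMap_eq_smul_one, ← Algebra.algebraMap_eq_smul_one] at h1 h3
  have h1' := hinj h1
  have h3' := hinj h3
  apply h
  rw [h1'] at h3' ⊢
  linear_combination -4 * h3'

/-- If the minimal polynomial of a product of two vectors has a root in `K`, the even Clifford
algebra is not a division algebra over `K`. -/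
theorem not_forall_isUnit_of_root {K : Type*} [Field K] [Algebra F K] (hψ : ψ.IsSymm) {x y : W}
    (h : (2 * ψ x y) ^ 2 ≠ 4 * (ψ x x * ψ y y)) {r : K}
    (hr : r ^ 2 - algebraMap F K (2 * ψ x y) * r + algebraMap F K (ψ x x * ψ y y) = 0) :
    ¬ ∀ z : K ⊗[F] ↥(CliffordAlgebra.even (LinearMap.BilinMap.toQuadraticMap ψ)),
      z ≠ 0 → IsUnit z := by
  intro hdiv
  let α : CliffordAlgebra.even (LinearMap.BilinMap.toQuadraticMap ψ) :=
    ⟨ι _ x * ι _ y, ι_mul_ι_mem_evenOdd_zero _ _ _⟩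
  have hα : ∀ s : K, (1 : K) ⊗ₜ[F] α - s ⊗ₜ[F] 1 ≠ 0 := fun s hs => by
    obtain ⟨c, hc⟩ := Algebra.TensorProduct.exists_eq_smul_one_of_one_tmul (sub_eq_zero.mp hs)
    exact ι_mul_ι_ne_smul_one hψ h c (congrArg Subtype.val hc)
  have hαα : α * α = (2 * ψ x y) • α - (ψ x x * ψ y y) • 1 :=
    Subtype.ext (ι_mul_ι_mul_self hψ x y)
  have hprod : ((1 : K) ⊗ₜ[F] α - r ⊗ₜ[F] 1) *
      ((1 : K) ⊗ₜ[F] α - (algebraMap F K (2 * ψ x y) - r) ⊗ₜ[F] 1) = 0 := by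
    have h1 : r * (algebraMap F K (2 * ψ x y) - r) = algebraMap F K (ψ x x * ψ y y) := by
      linear_combination -hr
    simp only [sub_mul, mul_sub, Algebra.TensorProduct.tmul_mul_tmul, one_mul, mul_one, hαα, h1]
    simp only [TensorProduct.tmul_sub, TensorProduct.sub_tmul, TensorProduct.tmul_smul,
      Algebra.algebraMap_eq_smul_one, TensorProduct.smul_tmul']
    abel
  obtain ⟨u, hu⟩ := hdiv _ (hα r)
  rw [← hu, Units.mul_right_eq_zero] at hprod
  exact hα _ hprod

omit [CharZero F] in
/-- If the norm form of the even Clifford algebra is anisotropic over `K`, then the even Clifford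
algebra is a division algebra over `K`. -/
theorem isUnit_of_norm_ne_zero {K : Type*} [Field K] [Algebra F K] (hψ : ψ.IsSymm)
    (e : Module.Basis (Fin 3) F W) {a b c u v w : K} (ha : a = algebraMap F K (ψ (e 0) (e 0)))
    (hb : b = algebraMap F K (ψ (e 1) (e 1))) (hc : c = algebraMap F K (ψ (e 2) (e 2)))
    (hu : u = algebraMap F K (2 * ψ (e 1) (e 2))) (hv : v = algebraMap F K (2 * ψ (e 0) (e 2)))
    (hw : w = algebraMap F K (2 * ψ (e 0) (e 1)))
    (hN : ∀ t α β γ : K, t ^ 2 + a * b * α ^ 2 + a * c * β ^ 2 + b * c * γ ^ 2 +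
      t * (w * α + v * β + u * γ) + u * a * α * β + (u * w - b * v) * α * γ + c * w * β * γ = 0 →
      t = 0 ∧ α = 0 ∧ β = 0 ∧ γ = 0)
    (z : K ⊗[F] ↥(CliffordAlgebra.even (LinearMap.BilinMap.toQuadraticMap ψ))) (hz : z ≠ 0) :
    IsUnit z := by
  let E : Fin 3 → Fin 3 → CliffordAlgebra.even (LinearMap.BilinMap.toQuadraticMap ψ) := fun i j =>
    ⟨ι _ (e i) * ι _ (e j), ι_mul_ι_mem_evenOdd_zero _ _ _⟩
  let I : CliffordAlgebra.even (LinearMap.BilinMap.toQuadraticMap ψ) →ₐ[F]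
      K ⊗[F] ↥(CliffordAlgebra.even (LinearMap.BilinMap.toQuadraticMap ψ)) :=
    Algebra.TensorProduct.includeRight
  have hspan : ∀ z : K ⊗[F] ↥(CliffordAlgebra.even (LinearMap.BilinMap.toQuadraticMap ψ)),
      ∃ t α β γ : K, z = t • 1 + α • I (E 0 1) + β • I (E 0 2) + γ • I (E 1 2) := by
    intro z
    induction z with
    | zero => exact ⟨0, 0, 0, 0, by simp⟩
    | add x y hx hy =>
      obtain ⟨t, α, β, γ, rfl⟩ := hx
      obtain ⟨t', α', β', γ', rfl⟩ := hy
      exact ⟨t + t', α + α', β + β', γ + γ', by module⟩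
    | tmul s y =>
      obtain ⟨t, α, β, γ, hy⟩ := exists_of_mem_even hψ e y.2
      have hy' : y = t • 1 + α • E 0 1 + β • E 0 2 + γ • E 1 2 := Subtype.ext hy
      refine ⟨s * algebraMap F K t, s * algebraMap F K α, s * algebraMap F K β,
        s * algebraMap F K γ, ?_⟩
      have hs : s ⊗ₜ[F] y = s • I y := by simp [I, TensorProduct.smul_tmul']
      rw [hs, hy']
      simp only [map_add, map_smul, smul_add, mul_smul, algebraMap_smul, map_one]
  have hrel := (isCliffordTriple_ι hψ e).even_relations
  obtain ⟨r1, r2, r3, r4, r5, r6⟩ := hrel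
  have s1 : E 0 1 * E 0 1 = (2 * ψ (e 0) (e 1)) • E 0 1 - (ψ (e 0) (e 0) * ψ (e 1) (e 1)) • 1 := Subtype.ext r1
  have s2 : E 0 2 * E 0 2 = (2 * ψ (e 0) (e 2)) • E 0 2 - (ψ (e 0) (e 0) * ψ (e 2) (e 2)) • 1 := Subtype.ext r2
  have s3 : E 1 2 * E 1 2 = (2 * ψ (e 1) (e 2)) • E 1 2 - (ψ (e 1) (e 1) * ψ (e 2) (e 2)) • 1 := Subtype.ext r3
  have s4 : E 0 1 * E 0 2 + E 0 2 * E 0 1 = (2 * ψ (e 0) (e 1)) • E 0 2 + (2 * ψ (e 0) (e 2)) • E 0 1 -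
      (ψ (e 0) (e 0) * (2 * ψ (e 1) (e 2))) • 1 := Subtype.ext r4
  have s5 : E 0 1 * E 1 2 + E 1 2 * E 0 1 = (2 * ψ (e 1) (e 2)) • E 0 1 + (2 * ψ (e 0) (e 1)) • E 1 2 -
      ((2 * ψ (e 0) (e 1)) * (2 * ψ (e 1) (e 2)) - (2 * ψ (e 0) (e 2)) * ψ (e 1) (e 1)) • 1 := Subtype.ext r5
  have s6 : E 0 2 * E 1 2 + E 1 2 * E 0 2 = (2 * ψ (e 1) (e 2)) • E 0 2 + (2 * ψ (e 0) (e 2)) • E 1 2 -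
      (ψ (e 2) (e 2) * (2 * ψ (e 0) (e 1))) • 1 := Subtype.ext r6
  replace s1 := congrArg I s1
  replace s2 := congrArg I s2
  replace s3 := congrArg I s3
  replace s4 := congrArg I s4
  replace s5 := congrArg I s5
  replace s6 := congrArg I s6
  simp only [map_add, map_sub, map_mul I, map_smul, map_one I, ← algebraMap_smul K (_ : F)]
    at s1 s2 s3 s4 s5 s6
  simp only [map_mul] at s1 s2 s3 s4 s5 s6
  simp only [map_mul] at hu hv hw
  simp only [← ha, ← hb, ← hc, ← hu, ← hv, ← hw] at s1 s2 s3 s4 s5 s6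
  obtain ⟨t, α, β, γ, rfl⟩ := hspan z
  refine IsCliffordTriple.isUnit_of_norm s1 s2 s3 s4 s5 s6 t α β γ fun h0 => hz ?_
  obtain ⟨rfl, rfl, rfl, rfl⟩ := hN t α β γ h0
  simp

end CliffordAlgebra

end

section

open Paper IsDedekindDomain

namespace IsDedekindDomain.HeightOneSpectrum

variable {R F : Type*} [CommRing R] [IsDedekindDomain R] [Field F] [Algebra R F]
  [IsFractionRing R F] (v : HeightOneSpectrum R)

theorem valuation_le_one_of_mem_range {x : F} (hx : x ∈ (algebraMap R F).range) :
    v.valuation F x ≤ 1 := by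
  obtain ⟨r, rfl⟩ := hx
  exact v.valuation_le_one r

theorem dvd_valuationSubring_iff {a b : (v.valuation F).valuationSubring} :
    a ∣ b ↔ v.valuation F b ≤ v.valuation F a := by
  constructor
  · rintro ⟨c, rfl⟩
    rw [Subring.coe_mul, map_mul]
    exact mul_le_of_le_one_right' c.2
  · intro h
    by_cases ha : a = 0
    · subst ha
      have : b = 0 := by
        apply Subtype.ext
        simpa using h
      simp [this]
    · have ha' : (a : F) ≠ 0 := fun h => ha (Subtype.ext h)
      have hv : v.valuation F (a : F) ≠ 0 := by simpa using ha'
      refine ⟨⟨b / a, ?_⟩, Subtype.ext ?_⟩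
      · rw [Valuation.mem_valuationSubring_iff, map_div₀]
        exact div_le_one_of_le₀ h zero_le
      · simp [mul_div_cancel₀ _ ha']

theorem isUnit_valuationSubring_iff {a : (v.valuation F).valuationSubring} :
    IsUnit a ↔ v.valuation F a = 1 := by
  rw [isUnit_iff_dvd_one, dvd_valuationSubring_iff]
  simp only [OneMemClass.coe_one, map_one]
  exact ⟨fun h => le_antisymm a.2 h, fun h => h.ge⟩

theorem lt_one_iff_le_exp {x : WithZero (Multiplicative ℤ)} :
    x < 1 ↔ x ≤ WithZero.exp (-1 : ℤ) := by
  induction x using WithZero.expRecOn with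
  | zero => simp
  | exp n =>
    rw [← WithZero.exp_zero, WithZero.exp_lt_exp, WithZero.exp_le_exp]
    lia

instance finite_residueField [Finite (R ⧸ v.asIdeal)] :
    Finite (IsLocalRing.ResidueField (v.valuation F).valuationSubring) := by
  let ι : R →+* (v.valuation F).valuationSubring :=
    (algebraMap R F).codRestrict (v.valuation F).valuationSubring fun r =>
      v.valuation_le_one r
  let f : R →+* IsLocalRing.ResidueField (v.valuation F).valuationSubring :=
    (IsLocalRing.residue _).comp ι
  have hι : ∀ r, f r = 0 ↔ r ∈ v.asIdeal := fun r => by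
    have : f r = 0 ↔ ¬ IsUnit (ι r) := by
      simp [f, IsLocalRing.residue_eq_zero_iff]
    rw [this, isUnit_valuationSubring_iff, ← v.valuation_lt_one_iff_mem (K := F)]
    exact ⟨fun h => lt_of_le_of_ne (ι r).2 h, fun h => h.ne⟩
  have hf : Function.Surjective f := by
    intro y
    obtain ⟨x, rfl⟩ := IsLocalRing.residue_surjective y
    obtain ⟨n, d, hx⟩ := v.exists_primeCompl_mul_eq_of_integer (x : F) x.2
    have hx' : x * ι d = ι n := Subtype.ext hx
    obtain ⟨t, ht⟩ : ∃ t, t * (d : R) - 1 ∈ v.asIdeal := by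
      obtain ⟨t, m, hm, h⟩ := v.isMaximal.exists_inv d.2
      exact ⟨t, by rw [← neg_mem_iff]; convert hm using 1; rw [← h]; ring⟩
    have h1 : f t * f d = 1 := by
      rw [← sub_eq_zero, ← map_mul, ← map_one f, ← map_sub]
      exact (hι _).mpr ht
    have h2 : IsLocalRing.residue _ x * f d = f n := by
      simp only [f, RingHom.comp_apply, ← map_mul, hx']
    exact ⟨n * t, by rw [map_mul, ← h2, mul_assoc, mul_comm (f d), h1, mul_one]⟩
  exact Finite.of_surjective (Ideal.Quotient.lift v.asIdeal f fun r hr => (hι r).mpr hr)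
    (Ideal.Quotient.lift_surjective_of_surjective _ _ hf)

end IsDedekindDomain.HeightOneSpectrum

namespace Paper

section GramForm

variable {F W : Type*} [Field F] [AddCommGroup W] [Module F W]

/-- The coefficients of the quadratic form of `ψ` along three vectors. -/
@[simps]
def gramForm (ψ : LinearMap.BilinForm F W) (e : Fin 3 → W) : TernaryForm F where
  a := ψ (e 0) (e 0)
  b := ψ (e 1) (e 1)
  c := ψ (e 2) (e 2)
  u := 2 * ψ (e 1) (e 2)
  v := 2 * ψ (e 0) (e 2)
  w := 2 * ψ (e 0) (e 1)

variable {ψ : LinearMap.BilinForm F W}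

theorem gramForm_eval (hψ : ψ.IsSymm) (e : Fin 3 → W) (x : Fin 3 → F) :
    (gramForm ψ e).eval x = ψ (∑ i, x i • e i) (∑ i, x i • e i) := by
  have h1 : ψ (e 1) (e 0) = ψ (e 0) (e 1) := hψ.eq _ _
  have h2 : ψ (e 2) (e 0) = ψ (e 0) (e 2) := hψ.eq _ _
  have h3 : ψ (e 2) (e 1) = ψ (e 1) (e 2) := hψ.eq _ _
  simp [TernaryForm.eval, Fin.sum_univ_three, h1, h2, h3]
  ring

theorem gramForm_polar (hψ : ψ.IsSymm) (e : Fin 3 → W) (x y : Fin 3 → F) :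
    (gramForm ψ e).polar x y = 2 * ψ (∑ i, x i • e i) (∑ i, y i • e i) := by
  have h1 : ψ (e 1) (e 0) = ψ (e 0) (e 1) := hψ.eq _ _
  have h2 : ψ (e 2) (e 0) = ψ (e 0) (e 2) := hψ.eq _ _
  have h3 : ψ (e 2) (e 1) = ψ (e 1) (e 2) := hψ.eq _ _
  simp [TernaryForm.polar, Fin.sum_univ_three, h1, h2, h3]
  ring

theorem gramForm_subst (hψ : ψ.IsSymm) (e : Fin 3 → W) (P : Matrix (Fin 3) (Fin 3) F) :
    (gramForm ψ e).subst P = gramForm ψ fun i => ∑ j, P i j • e j := by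
  ext <;> simp only [TernaryForm.subst, gramForm_eval hψ, gramForm_polar hψ] <;> rfl

theorem gramForm_disc_of_basis (hψ : ψ.IsSymm) (k : Module.Basis (Fin 3) F W)
    (horth : ∀ i j, i ≠ j → ψ (k i) (k j) = 0) (e : Fin 3 → W) :
    (gramForm ψ e).disc =
      4 * (ψ (k 0) (k 0) * ψ (k 1) (k 1) * ψ (k 2) (k 2)) * k.det e ^ 2 := by
  have he : e = fun i => ∑ j, (Matrix.of fun i j => k.repr (e i) j) i j • k j := by
    funext i
    exact (k.sum_repr (e i)).symm
  have hdet : k.det e = (Matrix.of fun i j => k.repr (e i) j).det := by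
    rw [Module.Basis.det_apply, ← Matrix.det_transpose]
    rfl
  rw [hdet]
  conv_lhs => rw [he]
  rw [← gramForm_subst hψ, TernaryForm.disc_subst]
  simp only [TernaryForm.disc, gramForm, horth 0 1 (by decide), horth 0 2 (by decide),
    horth 1 2 (by decide)]
  ring

end GramForm

end Paper

end

section

open Paper IsDedekindDomain

namespace Paper

section Maximal

variable {R F W : Type*} [CommRing R] [Field F] [Algebra R F] [AddCommGroup W] [Module F W]
  [Module R W] [IsScalarTower R F W] {ψ : LinearMap.BilinForm F W} {M : Submodule R W}

omit [IsScalarTower R F W] in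
theorem IsIntegralLat.two_mul_mem (hψ : ψ.IsSymm) (hM : IsIntegralLat R F W ψ M) {x y : W}
    (hx : x ∈ M) (hy : y ∈ M) : 2 * ψ x y ∈ (algebraMap R F).range := by
  have h1 : ψ y x = ψ x y := hψ.eq _ _
  have h2 : 2 * ψ x y = ψ (x + y) (x + y) - ψ x x - ψ y y := by
    simp only [map_add, LinearMap.add_apply, h1]
    ring
  rw [h2]
  exact sub_mem (sub_mem (hM.2 _ (add_mem hx hy)) (hM.2 _ hx)) (hM.2 _ hy)

theorem IsMaximalLat.mem_of_integral (hψ : ψ.IsSymm) (hM : IsMaximalLat R F W ψ M) {g : W}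
    (hg : ψ g g ∈ (algebraMap R F).range)
    (hgM : ∀ x ∈ M, 2 * ψ g x ∈ (algebraMap R F).range) : g ∈ M := by
  have hint : IsIntegralLat R F W ψ (M ⊔ Submodule.span R {g}) := by
    refine ⟨⟨hM.1.1.1.sup (Submodule.fg_span_singleton g), ?_⟩, ?_⟩
    · refine top_le_iff.mp (hM.1.1.2 ▸ Submodule.span_mono ?_)
      exact fun x hx => (le_sup_left : M ≤ M ⊔ Submodule.span R {g}) hx
    · intro x hx
      obtain ⟨m, hm, y, hy, rfl⟩ := Submodule.mem_sup.mp hx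
      obtain ⟨r, rfl⟩ := Submodule.mem_span_singleton.mp hy
      have h1 : ψ m g = ψ g m := hψ.eq _ _
      have h2 : ψ (m + r • g) (m + r • g) =
          ψ m m + algebraMap R F r * (2 * ψ g m) + algebraMap R F r ^ 2 * ψ g g := by
        rw [← algebraMap_smul F r g]
        simp only [map_add, map_smul, LinearMap.add_apply, LinearMap.smul_apply, h1, smul_eq_mul]
        ring
      rw [h2]
      exact add_mem (add_mem (hM.1.2 m hm) (mul_mem (RingHom.mem_range_self _ r) (hgM m hm)))
        (mul_mem (pow_mem (RingHom.mem_range_self _ r) 2) hg)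
  rw [← hM.2 _ hint le_sup_left]
  exact Submodule.mem_sup_right (Submodule.mem_span_singleton_self g)

end Maximal

section Local

variable {R F W : Type*} [CommRing R] [IsDedekindDomain R] [Field F] [Algebra R F]
  [IsFractionRing R F] [AddCommGroup W] [Module F W]
  [Module R W] [IsScalarTower R F W] {ψ : LinearMap.BilinForm F W} {M : Submodule R W}
  {v : HeightOneSpectrum R} {e : Module.Basis (Fin 3) F W}

omit [IsScalarTower R F W] in
theorem IsLocalBasis.valuation_le_one (he : IsLocalBasis F v M e) (f : W →ₗ[F] F)
    (hf : ∀ i, v.valuation F (f (e i)) ≤ 1) {x : W} (hx : x ∈ M) : v.valuation F (f x) ≤ 1 := by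
  rw [← e.sum_repr x, map_sum]
  refine Valuation.map_sum_le _ fun i _ => ?_
  rw [map_smul, smul_eq_mul, map_mul]
  exact mul_le_one' (he.repr_le x hx i) (hf i)

theorem IsMaximalLat.valuation_repr_le (hψ : ψ.IsSymm) (hM : IsMaximalLat R F W ψ M)
    (he : IsLocalBasis F v M e) {g : W} (hg : v.valuation F (ψ g g) ≤ 1)
    (hge : ∀ i, v.valuation F (2 * ψ g (e i)) ≤ 1) (i : Fin 3) :
    v.valuation F (e.repr g i) ≤ 1 := by
  let f : W →ₗ[F] F := (2 : F) • ψ g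
  obtain ⟨s, hs, hsM⟩ := exists_smul_mem_of_fg v.asIdeal.primeCompl (N := M)
    (T := (LinearMap.range (Algebra.linearMap R F)).comap (f.restrictScalars R)) hM.1.1.1
    fun x hx => by
      obtain ⟨n, d, h⟩ := v.exists_primeCompl_mul_eq_of_integer (f x)
        (he.valuation_le_one f (fun i => by simpa [f] using hge i) hx)
      refine ⟨d, d.2, n, ?_⟩
      simp only [LinearMap.coe_restrictScalars, Algebra.linearMap_apply, ← h]
      rw [← algebraMap_smul F, map_smul, smul_eq_mul, mul_comm]
  obtain ⟨n, t, ht⟩ := v.exists_primeCompl_mul_eq_of_integer (ψ g g) hg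
  have hmem : (s * (t : R)) • g ∈ M := by
    rw [← algebraMap_smul F]
    refine hM.mem_of_integral hψ ⟨s ^ 2 * t * n, ?_⟩ fun x hx => ?_
    · simp only [map_smul, LinearMap.smul_apply, smul_eq_mul, map_mul, map_pow, ← ht]
      ring
    · obtain ⟨r, hr⟩ := hsM x hx
      refine ⟨t * r, ?_⟩
      have hr' : algebraMap R F r = algebraMap R F s * (2 * ψ g x) := by
        rw [← Algebra.linearMap_apply, hr]
        simp only [LinearMap.coe_restrictScalars]
        rw [← algebraMap_smul F, map_smul]
        simp [f]
      simp only [map_smul, LinearMap.smul_apply, smul_eq_mul, map_mul, hr']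
      ring
  have h := he.repr_le _ hmem i
  rwa [← algebraMap_smul F, map_smul, Finsupp.smul_apply, smul_eq_mul, map_mul,
    v.valuation_eq_one_of_notMem (mul_mem hs t.2), one_mul] at h

/-- The quadratic form of an integral lattice along a basis of its localisation at `v`. -/
def IsLocalBasis.form (hψ : ψ.IsSymm) (he : IsLocalBasis F v M e)
    (hM : IsIntegralLat R F W ψ M) : TernaryForm (v.valuation F).valuationSubring where
  a := ⟨ψ (e 0) (e 0), v.valuation_le_one_of_mem_range (hM.2 _ (he.mem 0))⟩
  b := ⟨ψ (e 1) (e 1), v.valuation_le_one_of_mem_range (hM.2 _ (he.mem 1))⟩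
  c := ⟨ψ (e 2) (e 2), v.valuation_le_one_of_mem_range (hM.2 _ (he.mem 2))⟩
  u := ⟨2 * ψ (e 1) (e 2),
    v.valuation_le_one_of_mem_range (hM.two_mul_mem hψ (he.mem 1) (he.mem 2))⟩
  v := ⟨2 * ψ (e 0) (e 2),
    v.valuation_le_one_of_mem_range (hM.two_mul_mem hψ (he.mem 0) (he.mem 2))⟩
  w := ⟨2 * ψ (e 0) (e 1),
    v.valuation_le_one_of_mem_range (hM.two_mul_mem hψ (he.mem 0) (he.mem 1))⟩

omit [IsScalarTower R F W] in
theorem IsLocalBasis.coe_form_eval (hψ : ψ.IsSymm) (he : IsLocalBasis F v M e)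
    (hM : IsIntegralLat R F W ψ M) (x : Fin 3 → (v.valuation F).valuationSubring) :
    ((he.form hψ hM).eval x : F) = ψ (∑ i, (x i : F) • e i) (∑ i, (x i : F) • e i) := by
  rw [← gramForm_eval hψ]
  rfl

omit [IsScalarTower R F W] in
theorem IsLocalBasis.coe_form_polar (hψ : ψ.IsSymm) (he : IsLocalBasis F v M e)
    (hM : IsIntegralLat R F W ψ M) (x y : Fin 3 → (v.valuation F).valuationSubring) :
    ((he.form hψ hM).polar x y : F) =
      2 * ψ (∑ i, (x i : F) • e i) (∑ i, (y i : F) • e i) := by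
  rw [← gramForm_polar hψ]
  rfl

omit [IsScalarTower R F W] in
theorem IsLocalBasis.coe_form_disc (hψ : ψ.IsSymm) (he : IsLocalBasis F v M e)
    (hM : IsIntegralLat R F W ψ M) :
    ((he.form hψ hM).disc : F) = (gramForm ψ e).disc := rfl

theorem IsMaximalLat.maximalAt_form (hψ : ψ.IsSymm) (hM : IsMaximalLat R F W ψ M)
    (he : IsLocalBasis F v M e) {π : (v.valuation F).valuationSubring} (hπ : π ≠ 0) :
    (he.form hψ hM.1).MaximalAt π := by
  intro x hx hxe i
  have hπ' : (π : F) ≠ 0 := fun h => hπ (Subtype.ext h)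
  let f : W := ∑ i, (x i : F) • e i
  have hf : ∀ i, e.repr ((π : F)⁻¹ • f) i = (π : F)⁻¹ * x i := fun i => by
    simp [f, Finsupp.single_apply]
  obtain ⟨y, hy⟩ := hx
  have h1 : ψ f f = (π : F) ^ 2 * y := by
    have := he.coe_form_eval hψ hM.1 x
    rw [hy] at this
    exact this.symm
  have h2 : ∀ i, ∃ z : (v.valuation F).valuationSubring, 2 * ψ f (e i) = π * z := fun i => by
    obtain ⟨z, hz⟩ := hxe i
    have := he.coe_form_polar hψ hM.1 x (Pi.single i 1)
    rw [hz] at this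
    refine ⟨z, ?_⟩
    rw [show ∑ j, ((Pi.single i 1 : Fin 3 → (v.valuation F).valuationSubring) j : F) • e j = e i by
      rw [Finset.sum_eq_single i] <;> simp +contextual] at this
    exact this.symm
  have h := hM.valuation_repr_le hψ he (g := (π : F)⁻¹ • f) (by
    simp only [map_smul, LinearMap.smul_apply, smul_eq_mul, h1]
    rw [show (π : F)⁻¹ * ((π : F)⁻¹ * ((π : F) ^ 2 * y)) = y by field_simp]
    exact y.2) (fun i => by
    obtain ⟨z, hz⟩ := h2 i
    simp only [map_smul, LinearMap.smul_apply, smul_eq_mul]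
    rw [mul_left_comm, hz, inv_mul_cancel_left₀ hπ']
    exact z.2) i
  rw [hf] at h
  exact ⟨⟨_, h⟩, Subtype.ext (by simp [mul_inv_cancel_left₀ hπ'])⟩

end Local

end Paper

end

section

open Paper IsDedekindDomain
open scoped TensorProduct

namespace Paper

/-- The even Clifford algebra of `ψ` becomes a division algebra over the completion at `v`. -/
def IsDivisionAt {R F W : Type*} [CommRing R] [IsDedekindDomain R] [Field F] [Algebra R F]
    [IsFractionRing R F] [AddCommGroup W] [Module F W] (ψ : LinearMap.BilinForm F W)
    (v : HeightOneSpectrum R) : Prop :=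
  ∀ x : v.adicCompletion F ⊗[F]
    ↥(CliffordAlgebra.even (LinearMap.BilinMap.toQuadraticMap ψ)), x ≠ 0 → IsUnit x

section Local

variable {R F W : Type*} [CommRing R] [IsDedekindDomain R] [Field F] [CharZero F] [Algebra R F]
  [IsFractionRing R F] [AddCommGroup W] [Module F W]
  [Module R W] {ψ : LinearMap.BilinForm F W} {M : Submodule R W}
  {v : HeightOneSpectrum R} {e : Module.Basis (Fin 3) F W}

omit [Module R W] in
theorem not_isDivisionAt_of_isUnit_polar (hψ : ψ.IsSymm) {x y : W}
    (hx : v.valuation F (ψ x x) < 1) (hy : v.valuation F (ψ y y) ≤ 1)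
    (hxy : v.valuation F (2 * ψ x y) = 1) : ¬ IsDivisionAt ψ v := by
  have hn : v.valuation F (ψ x x * ψ y y) < 1 := by
    rw [map_mul]
    exact (mul_le_of_le_one_right' hy).trans_lt hx
  obtain ⟨r, hr⟩ := exists_root_quadratic v hxy hn
  refine CliffordAlgebra.not_forall_isUnit_of_root hψ (fun h => ?_) hr
  have h4 : v.valuation F (4 * (ψ x x * ψ y y)) < 1 := by
    rw [map_mul]
    exact (mul_le_of_le_one_left' (v.valuation_le_one_of_mem_range (ofNat_mem _ 4))).trans_lt hn
  rw [← h, map_pow, hxy, one_pow] at h4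
  exact lt_irrefl _ h4

omit [CharZero F] [Module R W] in
theorem isDivisionAt_of_isAnisotropicAt (hψ : ψ.IsSymm)
    {T : TernaryForm (v.valuation F).valuationSubring}
    {π a b u' v' w : (v.valuation F).valuationSubring}
    (hπ : v.valuation F (π : F) = WithZero.exp (-1 : ℤ)) (hT : T.IsAnisotropicAt π a b u' v' w)
    (ha : (T.a : F) = ψ (e 0) (e 0)) (hb : (T.b : F) = ψ (e 1) (e 1))
    (hc : (T.c : F) = ψ (e 2) (e 2)) (hu : (T.u : F) = 2 * ψ (e 1) (e 2))
    (hv : (T.v : F) = 2 * ψ (e 0) (e 2)) (hw : (T.w : F) = 2 * ψ (e 0) (e 1)) :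
    IsDivisionAt ψ v := by
  have hlt : ∀ x : (v.valuation F).valuationSubring, v.valuation F (x : F) < 1 ↔ π ∣ x :=
    fun x => by
      rw [HeightOneSpectrum.dvd_valuationSubring_iff, hπ, HeightOneSpectrum.lt_one_iff_le_exp]
  have hmax := valued_eq_max_of_aniso v (a := (a : F)) (b := (b : F)) (w := (w : F)) a.2 b.2 w.2
    fun x y hx hy h => by
      have := hT.aniso ⟨x, hx⟩ ⟨y, hy⟩ ((hlt _).mp h)
      exact ⟨(hlt ⟨x, hx⟩).mpr this.1, (hlt ⟨y, hy⟩).mpr this.2⟩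
  let κ := algebraMap F (v.adicCompletion F)
  have hκ : ∀ f, Valued.v (κ f) = v.valuation F f := valued_algebraMap v
  have hπ0 : κ π ≠ 0 := by
    rw [← (Valued.v : Valuation (v.adicCompletion F) _).ne_zero_iff, hκ, hπ]
    exact WithZero.exp_ne_zero
  refine CliffordAlgebra.isUnit_of_norm_ne_zero hψ e (a := κ π * κ a) (b := κ π * κ b)
    (c := κ T.c) (u := κ π * κ u') (v := κ π * κ v') (w := κ π * κ w) ?_ ?_ ?_ ?_ ?_ ?_ ?_
  · rw [← ha, hT.ha]; simp [κ]
  · rw [← hb, hT.hb]; simp [κ]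
  · rw [← hc]
  · rw [← hu, hT.hu]; simp [κ]
  · rw [← hv, hT.hv]; simp [κ]
  · rw [← hw, hT.hw]; simp [κ]
  · intro t α β γ h
    have hm := Valuation.max_pow_le_of_aniso (Valued.v : Valuation (v.adicCompletion F) _)
      (a := κ a) (b := κ b) (c := κ T.c) (u := κ u') (v := κ v') (w := κ w) (p := κ π)
      (by rw [hκ]; exact a.2) (by rw [hκ]; exact b.2)
      (by rw [hκ]; exact HeightOneSpectrum.isUnit_valuationSubring_iff v |>.mp hT.hc)
      (by rw [hκ]; exact u'.2) (by rw [hκ]; exact v'.2) (by rw [hκ]; exact w.2)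
      (by rw [hκ, hπ]) hmax t (κ π * α) β γ (by rw [← h]; ring)
    obtain ⟨h1, h2, h3, h4⟩ := hm
    exact ⟨h1, (mul_eq_zero.mp h2).resolve_left hπ0, h3, h4⟩

variable [IsScalarTower R F W]

/-- The discriminant of a maximal lattice at `v`. -/
theorem IsMaximalLat.valuation_disc_cases [Finite (R ⧸ v.asIdeal)] (hψ : ψ.IsSymm)
    (hM : IsMaximalLat R F W ψ M) (he : IsLocalBasis F v M e) :
    (v.valuation F (gramForm ψ e).disc = 1 ∧ ¬ IsDivisionAt ψ v) ∨
      v.valuation F (gramForm ψ e).disc = WithZero.exp (-1 : ℤ) ∨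
      (v.valuation F (gramForm ψ e).disc = WithZero.exp (-2 : ℤ) ∧ IsDivisionAt ψ v) := by
  obtain ⟨p, hp⟩ := v.valuation_exists_uniformizer F
  let π : (v.valuation F).valuationSubring := ⟨p, by
    rw [Valuation.mem_valuationSubring_iff, hp, ← WithZero.exp_zero, WithZero.exp_le_exp]
    lia⟩
  have hπ : v.valuation F (π : F) = WithZero.exp (-1 : ℤ) := hp
  have hπ0 : π ≠ 0 := fun h => by
    rw [h, ZeroMemClass.coe_zero, map_zero] at hπ
    exact WithZero.exp_ne_zero hπ.symm
  have hlt : ∀ x : (v.valuation F).valuationSubring, π ∣ x ↔ v.valuation F (x : F) < 1 :=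
    fun x => by
      rw [HeightOneSpectrum.dvd_valuationSubring_iff, hπ, HeightOneSpectrum.lt_one_iff_le_exp]
  have hunit : ∀ x : (v.valuation F).valuationSubring, IsUnit x ↔ ¬ π ∣ x := fun x => by
    rw [HeightOneSpectrum.isUnit_valuationSubring_iff, hlt]
    exact ⟨fun h => h.not_lt, fun h => le_antisymm x.2 (not_lt.mp h)⟩
  let res := IsLocalRing.residue (v.valuation F).valuationSubring
  have hres : ∀ x, res x = 0 ↔ π ∣ x := fun x => by
    rw [IsLocalRing.residue_eq_zero_iff, IsLocalRing.mem_maximalIdeal, mem_nonunits_iff, hunit,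
      not_not]
  have hsurj : Function.Surjective res := IsLocalRing.residue_surjective
  have hmax := hM.maximalAt_form hψ he hπ0
  rw [← he.coe_form_disc hψ hM.1]
  by_cases hdisc : π ∣ (he.form hψ hM.1).disc
  · right
    obtain ⟨d, hd, h⟩ | ⟨⟨d, hd, h⟩, P, hP, a, b, u', v', w, hT⟩ :=
      hmax.disc_cases res hsurj hres hunit hdisc
    · left
      rw [h, Subring.coe_mul, map_mul, hπ, (v.isUnit_valuationSubring_iff).mp hd, mul_one]
    · right
      constructor
      · rw [h, Subring.coe_mul, map_mul, (v.isUnit_valuationSubring_iff).mp hd, mul_one,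
          Subring.coe_pow, map_pow, hπ, ← WithZero.exp_nsmul]
        rfl
      · let f : Fin 3 → W := fun i => ∑ j, (P i j : F) • e j
        have hf : IsUnit (e.det f) := by
          have : e.det f = (P.det : F) := by
            rw [Module.Basis.det_apply, ← Matrix.det_transpose]
            refine Eq.trans ?_ (RingHom.map_det (v.valuation F).valuationSubring.subtype P).symm
            congr 1
            ext i j
            simp [f, Module.Basis.toMatrix_apply, Finsupp.single_apply]
          rw [this]
          exact hP.map (v.valuation F).valuationSubring.subtype
        obtain ⟨hli, hsp⟩ := (Module.Basis.is_basis_iff_det e).mpr hf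
        have hcoe : ⇑(Module.Basis.mk hli hsp.ge) = f := Module.Basis.coe_mk _ _
        refine isDivisionAt_of_isAnisotropicAt (e := Module.Basis.mk hli hsp.ge) hψ hπ hT
          ?_ ?_ ?_ ?_ ?_ ?_ <;> rw [hcoe]
        · exact he.coe_form_eval hψ hM.1 _
        · exact he.coe_form_eval hψ hM.1 _
        · exact he.coe_form_eval hψ hM.1 _
        · exact he.coe_form_polar hψ hM.1 _ _
        · exact he.coe_form_polar hψ hM.1 _ _
        · exact he.coe_form_polar hψ hM.1 _ _
  · left
    refine ⟨(v.isUnit_valuationSubring_iff).mp ((hunit _).mpr hdisc), ?_⟩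
    obtain ⟨x, y, hx, hxy⟩ := TernaryForm.exists_isUnit_polar res hsurj hres hunit _ hdisc
    refine not_isDivisionAt_of_isUnit_polar hψ (x := ∑ i, (x i : F) • e i)
      (y := ∑ i, (y i : F) • e i) ?_ ?_ ?_
    · rw [← he.coe_form_eval hψ hM.1, ← hlt]
      exact hx
    · rw [← he.coe_form_eval hψ hM.1]
      exact ((he.form hψ hM.1).eval y).2
    · rw [← he.coe_form_polar hψ hM.1]
      exact (v.isUnit_valuationSubring_iff).mp hxy

end Local

end Paper

end

section

open Paper IsDedekindDomain

namespace CliffordAlgebra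

variable {F W : Type*} [Field F] [AddCommGroup W] [Module F W] {ψ : LinearMap.BilinForm F W}

theorem ι_mul_xi_mul_reverse_add (k : Module.Basis (Fin 3) F W) (hψ : ψ.IsSymm)
    (horth : ∀ i j, i ≠ j → ψ (k i) (k j) = 0) (w x y : W) :
    ι _ w * xi ψ k * reverse (ι _ x * ι _ y) + ι _ x * ι _ y * reverse (ι _ w * xi ψ k) =
      algebraMap F _ (2 * (ψ (k 0) (k 0) * ψ (k 1) (k 1) * ψ (k 2) (k 2)) *
        k.det ![w, x, y]) := by
  rw [reverse_ι_mul_xi k hψ horth, reverse.map_mul, reverse_ι, reverse_ι, mul_neg,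
    ← sub_eq_add_neg]
  have h1 : ι _ w * xi ψ k * (ι _ y * ι _ x) = ι _ w * ι _ y * ι _ x * xi ψ k := by
    rw [mul_assoc, ← mul_assoc (xi ψ k), ← ι_mul_xi k hψ horth, mul_assoc (ι _ y),
      ← ι_mul_xi k hψ horth]
    simp only [mul_assoc]
  rw [h1, ← mul_assoc, ← sub_mul, ι_mul_ι_mul_ι_sub k hψ horth, smul_mul_assoc,
    xi_mul_xi k hψ horth, smul_smul, Algebra.algebraMap_eq_smul_one]
  congr 1
  ring

end CliffordAlgebra

namespace Module.Basis

variable {F W : Type*} [Field F] [AddCommGroup W] [Module F W]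

theorem det_vecCons_eq_repr_mul (k e : Module.Basis (Fin 3) F W) (w : W) :
    k.det ![w, e 1, e 2] = e.repr w 0 * k.det e ∧ k.det ![w, e 0, e 2] = -(e.repr w 1 * k.det e) ∧
      k.det ![w, e 0, e 1] = e.repr w 2 * k.det e := by
  rw [AlternatingMap.eq_smul_basis_det e k.det]
  simp only [AlternatingMap.smul_apply, smul_eq_mul, e.det_self, mul_one]
  refine ⟨?_, ?_, ?_⟩ <;>
    simp [Module.Basis.det_apply, Matrix.det_fin_three, Module.Basis.toMatrix_apply] <;> ring

end Module.Basis

namespace Paper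

open CliffordAlgebra

variable {R F W : Type*} [CommRing R] [Field F] [Algebra R F]
   [AddCommGroup W] [Module F W]
  [Module R W] [IsScalarTower R F W] {ψ : LinearMap.BilinForm F W}

theorem mem_normDual_inf_minusPart {x : CliffordAlgebra (LinearMap.BilinMap.toQuadraticMap ψ)}
    {N : Submodule R W} :
    x ∈ normDual R F W _ (APlusSub R F W (LinearMap.BilinMap.toQuadraticMap ψ) N) ⊓
        minusPart R F W _ ↔
      (x ∈ CliffordAlgebra.even (LinearMap.BilinMap.toQuadraticMap ψ) ∧ reverse x = -x) ∧
        ∀ y ∈ APlus R F W (LinearMap.BilinMap.toQuadraticMap ψ) N,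
          ∃ r : R, algebraMap R _ r = x * reverse y + y * reverse x := by
  simp only [normDual, minusPart, APlusSub, Submodule.mem_inf, Submodule.mem_iInf,
    Submodule.mem_comap, oneLat, LinearMap.mem_range, Algebra.linearMap_apply, LinearMap.mem_ker,
    Subalgebra.mem_toSubmodule, evenR, Subalgebra.mem_restrictScalars, traceMap,
    LinearMap.coe_restrictScalars, LinearMap.add_apply, LinearMap.mulRight_apply,
    LinearMap.comp_apply, LinearMap.mulLeft_apply, LinearMap.id_apply, add_eq_zero_iff_eq_neg]
  tauto

variable [IsDedekindDomain R] [IsFractionRing R F] [CharZero F]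
  {v : HeightOneSpectrum R} {e : Module.Basis (Fin 3) F W} {N : Submodule R W}

omit [IsDedekindDomain R] [IsFractionRing R F] [CharZero F] in
theorem ι_mul_ι_mem_APlus {x y : W} (hx : x ∈ N) (hy : y ∈ N) :
    ι _ x * ι _ y ∈ APlus R F W (LinearMap.BilinMap.toQuadraticMap ψ) N :=
  ⟨ι_mul_ι_mem_evenOdd_zero _ _ _,
    mul_mem (Algebra.subset_adjoin ⟨x, hx, rfl⟩) (Algebra.subset_adjoin ⟨y, hy, rfl⟩)⟩

theorem valuation_repr_mul_le_one (hψ : ψ.IsSymm) (k : Module.Basis (Fin 3) F W)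
    (horth : ∀ i j, i ≠ j → ψ (k i) (k j) = 0) (he : IsLocalBasis F v N e) {w : W}
    (hw : ι _ w * xi ψ k ∈ normDual R F W _ (APlusSub R F W (LinearMap.BilinMap.toQuadraticMap ψ) N)
      ⊓ minusPart R F W _) (i : Fin 3) :
    v.valuation F (e.repr w i * (2 * (ψ (k 0) (k 0) * ψ (k 1) (k 1) * ψ (k 2) (k 2)) *
      k.det e)) ≤ 1 := by
  let _ : Invertible (2 : F) := invertibleOfNonzero two_ne_zero
  have key : ∀ i j, v.valuation F (2 * (ψ (k 0) (k 0) * ψ (k 1) (k 1) * ψ (k 2) (k 2)) *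
      k.det ![w, e i, e j]) ≤ 1 := fun i j => by
    obtain ⟨r, hr⟩ := (mem_normDual_inf_minusPart.mp hw).2 _
      (ι_mul_ι_mem_APlus (ψ := ψ) (he.mem i) (he.mem j))
    rw [ι_mul_xi_mul_reverse_add k hψ horth, IsScalarTower.algebraMap_apply R F] at hr
    rw [← (algebraMap F (CliffordAlgebra (LinearMap.BilinMap.toQuadraticMap ψ))).injective hr]
    exact v.valuation_le_one r
  obtain ⟨h0, h1, h2⟩ := k.det_vecCons_eq_repr_mul e w
  have k0 := key 1 2
  have k1 := key 0 2
  have k2 := key 0 1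
  rw [h0] at k0
  rw [h1, mul_neg, Valuation.map_neg] at k1
  rw [h2] at k2
  fin_cases i
  · exact mul_left_comm (e.repr w 0) _ _ ▸ k0
  · exact mul_left_comm (e.repr w 1) _ _ ▸ k1
  · exact mul_left_comm (e.repr w 2) _ _ ▸ k2

theorem ι_mul_xi_mem (hψ : ψ.IsSymm) (k : Module.Basis (Fin 3) F W)
    (horth : ∀ i j, i ≠ j → ψ (k i) (k j) = 0) (hN : IsIntegralLat R F W ψ N) {w : W}
    (hw : ∀ v : HeightOneSpectrum R, ∃ e : Module.Basis (Fin 3) F W, IsLocalBasis F v N e ∧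
      ∀ i, v.valuation F (e.repr w i * (2 * (ψ (k 0) (k 0) * ψ (k 1) (k 1) * ψ (k 2) (k 2)) *
        k.det e)) ≤ 1) :
    ι _ w * xi ψ k ∈ normDual R F W _ (APlusSub R F W (LinearMap.BilinMap.toQuadraticMap ψ) N)
      ⊓ minusPart R F W _ := by
  let _ : Invertible (2 : F) := invertibleOfNonzero two_ne_zero
  refine mem_normDual_inf_minusPart.mpr
    ⟨⟨ι_mul_xi_mem_even k w, reverse_ι_mul_xi k hψ horth w⟩, fun y hy => ?_⟩
  have htr : ∀ (e : Fin 3 → W) (t α β γ : F), y = t • 1 + α • (ι _ (e 0) * ι _ (e 1)) +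
      β • (ι _ (e 0) * ι _ (e 2)) + γ • (ι _ (e 1) * ι _ (e 2)) →
      ι _ w * xi ψ k * reverse y + y * reverse (ι _ w * xi ψ k) = algebraMap F _
        (2 * (ψ (k 0) (k 0) * ψ (k 1) (k 1) * ψ (k 2) (k 2)) * (α * k.det ![w, e 0, e 1] +
          β * k.det ![w, e 0, e 2] + γ * k.det ![w, e 1, e 2])) := by
    intro e t α β γ h
    let T := LinearMap.mulLeft F (ι (LinearMap.BilinMap.toQuadraticMap ψ) w * xi ψ k) ∘ₗ reverse +
      LinearMap.mulRight F (reverse (ι (LinearMap.BilinMap.toQuadraticMap ψ) w * xi ψ k))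
    have h0 : T 1 = 0 := by
      simp only [T, LinearMap.add_apply, LinearMap.comp_apply, LinearMap.mulLeft_apply,
        LinearMap.mulRight_apply, reverse.map_one, mul_one, one_mul, reverse_ι_mul_xi k hψ horth]
      exact add_neg_cancel _
    have h1 : T (ι _ (e 0) * ι _ (e 1)) = _ := ι_mul_xi_mul_reverse_add k hψ horth w (e 0) (e 1)
    have h2 : T (ι _ (e 0) * ι _ (e 2)) = _ := ι_mul_xi_mul_reverse_add k hψ horth w (e 0) (e 2)
    have h3 : T (ι _ (e 1) * ι _ (e 2)) = _ := ι_mul_xi_mul_reverse_add k hψ horth w (e 1) (e 2)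
    change T y = _
    rw [h, map_add, map_add, map_add, map_smul, map_smul, map_smul, map_smul, h0, h1, h2, h3]
    simp only [Algebra.algebraMap_eq_smul_one]
    module
  obtain ⟨t, α, β, γ, h⟩ := exists_of_mem_even hψ k hy.1
  have hf := htr k t α β γ h
  set f := 2 * (ψ (k 0) (k 0) * ψ (k 1) (k 1) * ψ (k 2) (k 2)) * (α * k.det ![w, k 0, k 1] +
          β * k.det ![w, k 0, k 2] + γ * k.det ![w, k 1, k 2])
  obtain ⟨r, hr⟩ : ∃ r, algebraMap R F r = f := by
    refine HeightOneSpectrum.exists_algebraMap_of_forall_valuation_le_one fun v => ?_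
    obtain ⟨e, he, hew⟩ := hw v
    have hy' := mem_evenSpan_of_mem_APlus hψ e (O := (v.valuation F).valuationSubring.toSubring)
      (fun r => v.valuation_le_one r)
      (fun i => v.valuation_le_one_of_mem_range (hN.2 _ (he.mem i)))
      (fun i j => v.valuation_le_one_of_mem_range (hN.two_mul_mem hψ (he.mem i) (he.mem j)))
      N (fun n hn => ⟨e.repr n, he.repr_le n hn, (e.sum_repr n).symm⟩) hy
    obtain ⟨t', α', β', γ', h'⟩ := IsCliffordTriple.exists_of_mem_evenSpan _ hy'
    have hf' := htr e t' α' β' γ' h'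
    rw [hf] at hf'
    rw [(algebraMap F (CliffordAlgebra (LinearMap.BilinMap.toQuadraticMap ψ))).injective hf']
    obtain ⟨h0, h1, h2⟩ := k.det_vecCons_eq_repr_mul e w
    rw [h0, h1, h2]
    set c := 2 * (ψ (k 0) (k 0) * ψ (k 1) (k 1) * ψ (k 2) (k 2))
    rw [show c * (α' * (e.repr w 2 * k.det e) + β' * -(e.repr w 1 * k.det e) +
      γ' * (e.repr w 0 * k.det e)) = α' * (e.repr w 2 * (c * k.det e)) +
      -β' * (e.repr w 1 * (c * k.det e)) + γ' * (e.repr w 0 * (c * k.det e)) by ring]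
    refine Valuation.map_add_le _ (Valuation.map_add_le _ ?_ ?_) ?_ <;>
      rw [map_mul]
    · exact mul_le_one' α'.2 (hew 2)
    · rw [Valuation.map_neg]
      exact mul_le_one' β'.2 (hew 1)
    · exact mul_le_one' γ'.2 (hew 0)
  exact ⟨r, by rw [hf, ← hr, ← IsScalarTower.algebraMap_apply]⟩

end Paper

end

section

open Paper IsDedekindDomain CliffordAlgebra

namespace Paper

variable {R F W : Type*} [CommRing R] [IsDedekindDomain R] [Field F] [Algebra R F]
  [IsFractionRing R F] [AddCommGroup W] [Module F W] [Module R W] [IsScalarTower R F W]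
  {ψ : LinearMap.BilinForm F W} {N : Submodule R W}

/-- If `I` is locally generated by `2 δ det e` for local bases `e` of `N`, with `δ` minus the square
of `ξ`, then `N ξ` is the product of `I` and the pure part of the dual of `A⁺(N)`. -/
theorem map_ι_mul_xi_eq_idSMul [CharZero F] (hR : ¬ IsField R) (hψ : ψ.IsSymm)
    (k : Module.Basis (Fin 3) F W)
    (horth : ∀ i j, i ≠ j → ψ (k i) (k j) = 0) (hk : ∀ i, ψ (k i) (k i) ≠ 0)
    (hN : IsIntegralLat R F W ψ N) {I : Submodule R F} (hI : I.FG)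
    (hIv : ∀ v : HeightOneSpectrum R, ∃ e : Module.Basis (Fin 3) F W, IsLocalBasis F v N e ∧
      v.IsLocalValue I (v.valuation F
        (2 * (ψ (k 0) (k 0) * ψ (k 1) (k 1) * ψ (k 2) (k 2)) * k.det e))) :
    N.map (((LinearMap.mulRight F (xi ψ k)).comp
        (ι (LinearMap.BilinMap.toQuadraticMap ψ))).restrictScalars R) =
      idSMul R F I (normDual R F W _ (APlusSub R F W (LinearMap.BilinMap.toQuadraticMap ψ) N)
        ⊓ minusPart R F W _) := by
  apply le_antisymm
  · rintro _ ⟨n, hn, rfl⟩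
    refine mem_of_forall_exists_smul_mem hR fun v => ?_
    obtain ⟨e, he, hle, c, hc, hcv⟩ := hIv v
    have hc0 : c ≠ 0 := by
      rw [← (v.valuation F).ne_zero_iff, hcv, (v.valuation F).ne_zero_iff]
      exact mul_ne_zero (mul_ne_zero two_ne_zero (mul_ne_zero (mul_ne_zero (hk 0) (hk 1)) (hk 2)))
        (k.isUnit_det e).ne_zero
    obtain ⟨s, hs, hsI⟩ := exists_smul_mem_of_fg v.asIdeal.primeCompl (N := I)
      (T := (LinearMap.range (Algebra.linearMap R F)).comap
        ((LinearMap.mulLeft F c⁻¹).restrictScalars R)) hI fun x hx => by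
        obtain ⟨r, d, h⟩ := v.exists_primeCompl_mul_eq_of_integer (c⁻¹ * x) (by
          rw [map_mul, map_inv₀, mul_comm, ← div_eq_mul_inv, hcv]
          exact div_le_one_of_le₀ (hle x hx) zero_le)
        refine ⟨d, d.2, r, ?_⟩
        simp only [LinearMap.coe_restrictScalars, Algebra.linearMap_apply, ← h,
          LinearMap.mulLeft_apply, Algebra.smul_def]
        ring
    refine ⟨s, hs, Submodule.subset_span ⟨c, hc, ι _ ((algebraMap R F s * c⁻¹) • n) * xi ψ k,
      ι_mul_xi_mem hψ k horth hN fun v' => ?_, ?_⟩⟩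
    · obtain ⟨e', he', -, c', hc', hcv'⟩ := hIv v'
      refine ⟨e', he', fun i => ?_⟩
      obtain ⟨r, hr⟩ := hsI c' hc'
      have hr' : algebraMap R F r = algebraMap R F s * c⁻¹ * c' := by
        rw [← Algebra.linearMap_apply, hr]
        simp only [LinearMap.coe_restrictScalars, LinearMap.mulLeft_apply, Algebra.smul_def]
        ring
      rw [map_mul, ← hcv', ← map_mul, map_smul, Finsupp.smul_apply, smul_eq_mul,
        mul_right_comm, ← hr', map_mul]
      exact mul_le_one' (v'.valuation_le_one r) (he'.repr_le n hn i)
    · simp only [LinearMap.coe_restrictScalars, LinearMap.comp_apply, LinearMap.mulRight_apply,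
        map_smul, smul_mul_assoc, smul_smul]
      rw [mul_comm, inv_mul_cancel_right₀ hc0, algebraMap_smul]
  · rw [idSMul, Submodule.span_le]
    rintro _ ⟨c, hc, x, hx, rfl⟩
    obtain ⟨w, rfl⟩ := exists_ι_mul_xi k hψ horth hk (mem_normDual_inf_minusPart.mp hx).1.1
      (mem_normDual_inf_minusPart.mp hx).1.2
    refine ⟨c • w, mem_of_forall_exists_smul_mem hR fun v => ?_, by simp⟩
    obtain ⟨e, he, hle, -⟩ := hIv v
    refine he.exists_smul_mem fun i => ?_
    rw [map_smul, Finsupp.smul_apply, smul_eq_mul, map_mul]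
    refine (mul_le_mul_left (hle c hc) _).trans ?_
    rw [← map_mul, mul_comm]
    exact valuation_repr_mul_le_one hψ k horth he hx i

theorem finite_setOf_valuation_lt_one {x : F} (hx : x ≠ 0) :
    {v : HeightOneSpectrum R | v.valuation F x < 1}.Finite := by
  refine (HeightOneSpectrum.Support.finite R x⁻¹).subset fun v hv => ?_
  have h0 : v.valuation F x ≠ 0 := (v.valuation F).ne_zero_iff.mpr hx
  change 1 < v.valuation F x⁻¹
  rw [map_inv₀]
  exact (one_lt_inv₀ (zero_lt_iff.mpr h0)).mpr hv

theorem finite_setOf_isDivisionAt [CharZero F] [∀ v : HeightOneSpectrum R, Finite (R ⧸ v.asIdeal)]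
    (hW : Module.finrank F W = 3) (hψ : ψ.IsSymm)
    (k : Module.Basis (Fin 3) F W) (horth : ∀ i j, i ≠ j → ψ (k i) (k j) = 0)
    (hk : ∀ i, ψ (k i) (k i) ≠ 0) {M : Submodule R W} (hM : IsMaximalLat R F W ψ M) :
    {v : HeightOneSpectrum R | IsDivisionAt ψ v}.Finite := by
  obtain h | ⟨⟨v₀⟩⟩ := isEmpty_or_nonempty (HeightOneSpectrum R)
  · exact Set.toFinite _
  obtain ⟨f, hf⟩ := exists_isLocalBasis hW v₀ hM.1.1
  have h0 : (gramForm ψ f).disc ≠ 0 := by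
    rw [gramForm_disc_of_basis hψ k horth]
    exact mul_ne_zero (mul_ne_zero (OfNat.ofNat_ne_zero 4) (mul_ne_zero (mul_ne_zero (hk 0) (hk 1)) (hk 2)))
      (pow_ne_zero _ (k.isUnit_det f).ne_zero)
  refine (finite_setOf_valuation_lt_one (R := R) h0).subset fun v hv => ?_
  obtain ⟨e, he⟩ := exists_isLocalBasis hW v hM.1.1
  have h1 : v.valuation F (gramForm ψ e).disc < 1 := by
    obtain ⟨-, h⟩ | h | ⟨h, -⟩ := hM.valuation_disc_cases hψ he
    · exact absurd hv h
    · rw [h, HeightOneSpectrum.lt_one_iff_le_exp]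
    · rw [h, HeightOneSpectrum.lt_one_iff_le_exp, WithZero.exp_le_exp]
      lia
  have h2 : (gramForm ψ f).disc = (gramForm ψ e).disc * e.det f ^ 2 := by
    rw [gramForm_disc_of_basis hψ k horth, gramForm_disc_of_basis hψ k horth,
      ← k.det_mul_det e f]
    ring
  change v.valuation F (gramForm ψ f).disc < 1
  rw [h2, map_mul, map_pow]
  exact (mul_le_of_le_one_right' (pow_le_one' (he.valuation_det_le_one hf.mem) 2)).trans_lt h1

end Paper

end

section

open Paper IsDedekindDomain CliffordAlgebra

theorem WithZero.even_sub_of_sq_mul_eq {x : WithZero (Multiplicative ℤ)} {m n : ℤ}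
    (h : x ^ 2 * WithZero.exp m = WithZero.exp n) : Even (n - m) := by
  induction x using WithZero.expRecOn with
  | zero =>
    rw [zero_pow two_ne_zero, zero_mul] at h
    exact absurd h.symm WithZero.exp_ne_zero
  | exp a =>
    rw [← WithZero.exp_nsmul, ← WithZero.exp_add, WithZero.exp_inj] at h
    exact ⟨a, by rw [← h]; simp; ring⟩

namespace Paper

variable {R F W : Type*} [CommRing R] [IsDedekindDomain R] [Field F] [Algebra R F]
  [IsFractionRing R F] [AddCommGroup W] [Module F W] [Module R W] [IsScalarTower R F W]
  {ψ : LinearMap.BilinForm F W} {M : Submodule R W}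

omit [IsDedekindDomain R] [IsFractionRing R F] in
theorem ne_zero_of_span_singleton_eq [FaithfulSMul R F] {I : Ideal R} {J : Submodule R F} {x : F}
    (hI : I ≠ ⊥) (hJ : J ≠ ⊥) (h : Submodule.span R {x} = idealToF R F I * J * J) : x ≠ 0 := by
  obtain ⟨a, ha, ha0⟩ := Submodule.exists_mem_ne_zero_of_ne_bot hI
  obtain ⟨r, hr, hr0⟩ := Submodule.exists_mem_ne_zero_of_ne_bot hJ
  rintro rfl
  have hmem : algebraMap R F a * r * r ∈ Submodule.span R {(0 : F)} :=
    h ▸ Submodule.mul_mem_mul (Submodule.mul_mem_mul ⟨a, ha, rfl⟩ hr) hr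
  simp [ha0, hr0] at hmem

omit [IsFractionRing R F] in
theorem fg_of_span_singleton_eq [FaithfulSMul R F] {I : Ideal R} {J : Submodule R F} {x : F}
    (hI : I ≠ ⊥) (hJ : J ≠ ⊥) (h : Submodule.span R {x} = idealToF R F I * J * J) : J.FG := by
  obtain ⟨a, ha, ha0⟩ := Submodule.exists_mem_ne_zero_of_ne_bot hI
  obtain ⟨r, hr, hr0⟩ := Submodule.exists_mem_ne_zero_of_ne_bot hJ
  have ha0' : algebraMap R F a ≠ 0 := by simpa using ha0
  have hmap : J.map (LinearMap.mulLeft R (algebraMap R F a * r)) ≤ Submodule.span R {x} := by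
    rintro _ ⟨y, hy, rfl⟩
    rw [h]
    exact Submodule.mul_mem_mul (Submodule.mul_mem_mul ⟨a, ha, rfl⟩ hr) hy
  refine Submodule.fg_of_fg_map_injective _ ?_ ((Submodule.fg_span_singleton x).of_le hmap)
  exact fun y z hyz => mul_left_cancel₀ (mul_ne_zero ha0' hr0) hyz

theorem exists_isLocalValue_ramification [CharZero F] {v : HeightOneSpectrum R}
    [Finite (R ⧸ v.asIdeal)] (hψ : ψ.IsSymm)
    (k : Module.Basis (Fin 3) F W) (horth : ∀ i j, i ≠ j → ψ (k i) (k j) = 0)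
    (hk : ∀ i, ψ (k i) (k i) ≠ 0) (hM : IsMaximalLat R F W ψ M)
    {𝔞 D 𝔠 : Ideal R} {𝔯 : Submodule R F} (h𝔞 : Squarefree 𝔞) (h𝔯 : 𝔯.FG)
    (hξξ : Submodule.span R {ψ (k 0) (k 0) * ψ (k 1) (k 1) * ψ (k 2) (k 2)} =
      idealToF R F 𝔞 * 𝔯 * 𝔯)
    (hD : Squarefree D) (hDv : v.asIdeal ∣ D ↔ IsDivisionAt ψ v)
    (h𝔠 : Squarefree 𝔠) (h𝔠v : v.asIdeal ∣ 𝔠 ↔ v.asIdeal ∣ 𝔞 ∧ ¬ v.asIdeal ∣ D)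
    {e : Module.Basis (Fin 3) F W} (he : IsLocalBasis F v M e) :
    v.IsLocalValue (𝔯 * idealToF R F 𝔠 * idealToF R F D) (v.valuation F
      (2 * (ψ (k 0) (k 0) * ψ (k 1) (k 1) * ψ (k 2) (k 2)) * k.det e)) := by
  obtain ⟨γ, hγ⟩ := HeightOneSpectrum.exists_isLocalValue v h𝔯
  set δ := ψ (k 0) (k 0) * ψ (k 1) (k 1) * ψ (k 2) (k 2) with hδ
  have hδ0 : δ ≠ 0 := mul_ne_zero (mul_ne_zero (hk 0) (hk 1)) (hk 2)
  have hdisc := gramForm_disc_of_basis hψ k horth e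
  rw [← hδ] at hdisc
  have hval : ∀ α, v.IsLocalValue (idealToF R F 𝔞) α → v.valuation F δ = α * γ * γ := fun α hα =>
    (hξξ ▸ HeightOneSpectrum.isLocalValue_span_singleton v δ).unique ((hα.mul hγ).mul hγ)
  have hpar : ∀ α, v.IsLocalValue (idealToF R F 𝔞) α → v.valuation F (gramForm ψ e).disc =
      (v.valuation F (2 * k.det e) * γ) ^ 2 * α := fun α hα => by
    rw [hdisc, show 4 * δ * k.det e ^ 2 = (2 * k.det e) ^ 2 * δ by ring, map_mul, hval α hα,
      map_pow, mul_pow]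
    simp only [sq]
    ac_rfl
  have hsq : ∀ α, v.IsLocalValue (idealToF R F 𝔞) α → v.valuation F (2 * δ * k.det e) ^ 2 =
      v.valuation F (gramForm ψ e).disc * α * γ ^ 2 := fun α hα => by
    rw [← map_pow, show (2 * δ * k.det e) ^ 2 = (gramForm ψ e).disc * δ by rw [hdisc]; ring,
      map_mul, hval α hα]
    simp only [sq]
    ac_rfl
  have hfin : ∀ β ε α, v.IsLocalValue (idealToF R F 𝔠) β → v.IsLocalValue (idealToF R F D) ε →
      v.IsLocalValue (idealToF R F 𝔞) α →
      v.valuation F (gramForm ψ e).disc * α = (β * ε) ^ 2 →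
      v.IsLocalValue (𝔯 * idealToF R F 𝔠 * idealToF R F D)
        (v.valuation F (2 * δ * k.det e)) := fun β ε α hβ hε hα h => by
    have h1 : v.valuation F (2 * δ * k.det e) = γ * β * ε := by
      refine (pow_left_inj₀ zero_le zero_le two_ne_zero).mp ?_
      rw [hsq α hα, h]
      simp only [sq]
      ac_rfl
    rw [h1]
    exact (hγ.mul hβ).mul hε
  have ha : (v.asIdeal ∣ 𝔞 ∧ v.IsLocalValue (idealToF R F 𝔞) (WithZero.exp (-1 : ℤ))) ∨
      (¬ v.asIdeal ∣ 𝔞 ∧ v.IsLocalValue (idealToF R F 𝔞) 1) := by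
    by_cases h : v.asIdeal ∣ 𝔞
    · exact .inl ⟨h, HeightOneSpectrum.isLocalValue_idealToF_of_dvd h𝔞 h⟩
    · exact .inr ⟨h, HeightOneSpectrum.isLocalValue_idealToF_of_not_dvd h⟩
  obtain ⟨hΔ, hdiv⟩ | hΔ | ⟨hΔ, hdiv⟩ := hM.valuation_disc_cases hψ he
  · have hDn := mt hDv.mp hdiv
    obtain ⟨h1, h2⟩ | ⟨h1, h2⟩ := ha
    · have := WithZero.even_sub_of_sq_mul_eq ((hpar _ h2).symm.trans hΔ)
      exact absurd this (by decide)
    · have h𝔠n : ¬ v.asIdeal ∣ 𝔠 := fun h => h1 (h𝔠v.mp h).1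
      exact hfin 1 1 1 (HeightOneSpectrum.isLocalValue_idealToF_of_not_dvd h𝔠n)
        (HeightOneSpectrum.isLocalValue_idealToF_of_not_dvd hDn) h2 (by simp [hΔ])
  · obtain ⟨h1, h2⟩ | ⟨h1, h2⟩ := ha
    · by_cases hDd : v.asIdeal ∣ D
      · have h𝔠n : ¬ v.asIdeal ∣ 𝔠 := fun h => (h𝔠v.mp h).2 hDd
        exact hfin _ _ _ (HeightOneSpectrum.isLocalValue_idealToF_of_not_dvd h𝔠n)
          (HeightOneSpectrum.isLocalValue_idealToF_of_dvd hD hDd) h2 (by rw [hΔ, one_mul, sq])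
      · exact hfin _ _ _
          (HeightOneSpectrum.isLocalValue_idealToF_of_dvd h𝔠 (h𝔠v.mpr ⟨h1, hDd⟩))
          (HeightOneSpectrum.isLocalValue_idealToF_of_not_dvd hDd) h2 (by rw [hΔ, mul_one, sq])
    · have := WithZero.even_sub_of_sq_mul_eq ((hpar _ h2).symm.trans hΔ)
      exact absurd this (by decide)
  · have hDd := hDv.mpr hdiv
    obtain ⟨h1, h2⟩ | ⟨h1, h2⟩ := ha
    · have := WithZero.even_sub_of_sq_mul_eq ((hpar _ h2).symm.trans hΔ)
      exact absurd this (by decide)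
    · have h𝔠n : ¬ v.asIdeal ∣ 𝔠 := fun h => h1 (h𝔠v.mp h).1
      exact hfin _ _ _ (HeightOneSpectrum.isLocalValue_idealToF_of_not_dvd h𝔠n)
        (HeightOneSpectrum.isLocalValue_idealToF_of_dvd hD hDd) h2
        (by rw [hΔ, one_mul, mul_one, ← WithZero.exp_nsmul]; rfl)

theorem map_ι_mul_xi_eq [CharZero F] [∀ v : HeightOneSpectrum R, Finite (R ⧸ v.asIdeal)]
    (hR : ¬ IsField R) (hW : Module.finrank F W = 3) (hψ : ψ.IsSymm) {N : Submodule R W}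
    (hN : IsIntegralLat R F W ψ N) (hM : IsMaximalLat R F W ψ M)
    {k : Fin 3 → W} (hk : Submodule.span F (Set.range k) = ⊤)
    (horth : ∀ i j, i ≠ j → ψ (k i) (k j) = 0)
    {𝔞 D 𝔠 : Ideal R} {𝔯 : Submodule R F} (h𝔞 : Squarefree 𝔞) (h𝔯 : 𝔯 ≠ ⊥)
    (hξξ : Submodule.span R {ψ (k 0) (k 0) * ψ (k 1) (k 1) * ψ (k 2) (k 2)} =
      idealToF R F 𝔞 * 𝔯 * 𝔯)
    (hD : D = ∏ᶠ v ∈ {v : HeightOneSpectrum R | IsDivisionAt ψ v}, v.asIdeal)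
    (h𝔠 : 𝔠 = ∏ᶠ v ∈ {v : HeightOneSpectrum R | v.asIdeal ∣ 𝔞 ∧ ¬ v.asIdeal ∣ D}, v.asIdeal) :
    N.map (((LinearMap.mulRight F (xi ψ k)).comp
        (ι (LinearMap.BilinMap.toQuadraticMap ψ))).restrictScalars R) =
      idSMul R F (𝔯 * idealToF R F 𝔠 * idealToF R F D * latIdx R F W M N)
        (normDual R F W _ (APlusSub R F W (LinearMap.BilinMap.toQuadraticMap ψ) N)
          ⊓ minusPart R F W _) := by
  obtain ⟨k, rfl⟩ : ∃ k' : Module.Basis (Fin 3) F W, ⇑k' = k :=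
    ⟨basisOfTopLeSpanOfCardEqFinrank k hk.ge (by simp [hW]), by simp⟩
  have h𝔞0 : 𝔞 ≠ ⊥ := h𝔞.ne_zero
  have hδ := ne_zero_of_span_singleton_eq h𝔞0 h𝔯 hξξ
  have hk0 : ∀ i, ψ (k i) (k i) ≠ 0 := by
    simp only [mul_ne_zero_iff] at hδ
    exact Fin.forall_fin_succ.mpr ⟨hδ.1.1, Fin.forall_fin_two.mpr ⟨hδ.1.2, hδ.2⟩⟩
  have hfg := fg_of_span_singleton_eq h𝔞0 h𝔯 hξξ
  have hDfin := finite_setOf_isDivisionAt hW hψ k horth hk0 hM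
  have h𝔠fin : {v : HeightOneSpectrum R | v.asIdeal ∣ 𝔞 ∧ ¬ v.asIdeal ∣ D}.Finite :=
    (Ideal.finite_factors h𝔞0).subset fun v hv => hv.1
  have hfgI : ∀ I : Ideal R, (idealToF R F I).FG := fun I => (IsNoetherian.noetherian I).map _
  refine map_ι_mul_xi_eq_idSMul hR hψ k horth hk0 hN
    (((hfg.mul (hfgI _)).mul (hfgI _)).mul (fg_latIdx hW hM.1.1 hN.1)) fun v => ?_
  obtain ⟨e, he⟩ := exists_isLocalBasis hW v hM.1.1
  obtain ⟨f, hf⟩ := exists_isLocalBasis hW v hN.1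
  refine ⟨f, hf, ?_⟩
  have h1 := exists_isLocalValue_ramification hψ k horth hk0 hM h𝔞 hfg hξξ
    (hD ▸ HeightOneSpectrum.squarefree_finprod_asIdeal hDfin)
    (hD ▸ HeightOneSpectrum.dvd_finprod_asIdeal_iff hDfin)
    (h𝔠 ▸ HeightOneSpectrum.squarefree_finprod_asIdeal h𝔠fin)
    (h𝔠 ▸ HeightOneSpectrum.dvd_finprod_asIdeal_iff h𝔠fin) he
  have h2 := h1.mul (isLocalValue_latIdx hM.1.1.1 he hf)
  rwa [← map_mul, mul_assoc _ (k.det e), k.det_mul_det] at h2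

end Paper

end

section

open Paper IsDedekindDomain

theorem LinearMap.finrank_ker_of_ne_zero {F V : Type*} [Field F] [AddCommGroup V] [Module F V]
    [FiniteDimensional F V] {f : V →ₗ[F] F} (hf : f ≠ 0) :
    Module.finrank F (LinearMap.ker f) + 1 = Module.finrank F V := by
  rw [← f.finrank_range_add_finrank_ker, LinearMap.range_eq_top.mpr (LinearMap.surjective hf),
    finrank_top, Module.finrank_self, add_comm]

section IntegralClosure

variable {R F : Type*} [CommRing R] [Field F] [Algebra R F] [IsIntegralClosure R ℤ F]

theorem IsIntegralClosure.not_isField_of_int [CharZero F] : ¬ IsField R := by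
  intro hR
  have hinj : Function.Injective (algebraMap R F) := IsIntegralClosure.algebraMap_injective R ℤ F
  have : Algebra.IsIntegral ℤ R := IsIntegralClosure.isIntegral_algebra ℤ F
  have := hR.isDomain
  have : FaithfulSMul ℤ R := (faithfulSMul_iff_algebraMap_injective ℤ R).mpr
    (Function.Injective.of_comp (f := algebraMap R F) (by
      rw [← RingHom.coe_comp, RingHom.eq_intCast' ((algebraMap R F).comp _)]
      exact Int.cast_injective))
  exact Int.not_isField ((Algebra.IsIntegral.isField_iff_isField
    (FaithfulSMul.algebraMap_injective ℤ R)).mpr hR)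

theorem IsIntegralClosure.finite_quotient_of_int [NumberField F] [IsDedekindDomain R]
    {I : Ideal R} (hI : I ≠ ⊥) : Finite (R ⧸ I) := by
  let e := NumberField.RingOfIntegers.equiv (K := F) R
  have hI' : I.map (e.symm : R →+* NumberField.RingOfIntegers F) ≠ ⊥ := fun h => hI <|
    (Ideal.map_eq_bot_iff_of_injective e.symm.injective).mp h
  have := Ideal.finiteQuotientOfFreeOfNeBot _ hI'
  exact Finite.of_equiv _ (Ideal.quotientEquiv I _ e.symm rfl).toEquiv.symm

end IntegralClosure

namespace Paper

theorem IsIntegralLat.comap_subtype {R F V : Type*} [CommRing R] [IsNoetherianRing R] [Field F]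
    [Algebra R F] [IsFractionRing R F] [AddCommGroup V] [Module F V] [Module R V]
    [IsScalarTower R F V] {φ : LinearMap.BilinForm F V} {L : Submodule R V}
    (hL : IsIntegralLat R F V φ L) (U : Submodule F V) :
    IsIntegralLat R F U (φ.restrict U) (L.comap (U.subtype.restrictScalars R)) := by
  refine ⟨⟨?_, ?_⟩, fun x hx => hL.2 x hx⟩
  · exact Submodule.fg_of_fg_map_injective _ Subtype.val_injective
      (hL.1.1.of_le (Submodule.map_comap_le _ _))
  · refine eq_top_iff.mpr fun x _ => ?_
    obtain ⟨s, hs, hx⟩ := exists_smul_mem_of_isLat hL.1 (x : V)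
    have hs0 : algebraMap R F s ≠ 0 := (IsLocalization.map_units F ⟨s, hs⟩).ne_zero
    rw [← inv_smul_smul₀ hs0 x, algebraMap_smul]
    exact Submodule.smul_mem _ _ (Submodule.subset_span hx)

end Paper

end

section Statement5

variable (F : Type*) [Field F] [NumberField F]
variable (R : Type*) [CommRing R] [IsDedekindDomain R] [Algebra R F] [IsFractionRing R F]
  [IsIntegralClosure R ℤ F]
variable (V : Type*) [AddCommGroup V] [Module F V] [Module R V] [IsScalarTower R F V]

set_option synthInstance.maxHeartbeats 1000000 in
set_option maxHeartbeats 1000000 in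
/-- Theorem 1 of the paper. Let `(V,φ)` be a quaternary quadratic space
over a number field `F`, `h ∈ V` with `φ[h] = q ≠ 0`, `W = (Fh)ᗮ`, `ψ = φ|_W`.  Fix an
isomorphism `ξ = k₁k₂k₃` of `(W,ψ)` onto `(A⁺(W)°, (ξξ*)⁻¹ν°)` coming from an orthogonal
basis of W.  Then for a maximal lattice L in V,
`(L∩W)ξ = 𝔯·𝔠·D_{Q(ψ)}·[M/L∩W]·(A⁺(L∩W)~ ∩ A⁺(W)°)`,
where `𝔠` is the product of the prime factors of `𝔞` prime to the discriminant
`D_{Q(ψ)}` of `A⁺(W)` and `M` is a maximal lattice in `(W,ψ)`. -/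
theorem statement5
    (hV : Module.finrank F V = 4)
    (φ : LinearMap.BilinForm F V) (hsymm : φ.IsSymm)
    (hnd : LinearMap.BilinForm.Nondegenerate φ)
    (h : V) (hq : φ h h ≠ 0)
    (Wsub : Submodule F V) (hWsub : Wsub = LinearMap.ker (φ.flip h))
    (L : Submodule R V) (hL : IsMaximalLat R F V φ L)
    (M : Submodule R ↥Wsub)
    (hM : IsMaximalLat R F ↥Wsub (LinearMap.BilinForm.restrict φ Wsub) M)
    -- an orthogonal basis of (W,ψ) giving ξ = k₀k₁k₂
    (k : Fin 3 → ↥Wsub) (hk : Submodule.span F (Set.range k) = ⊤)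
    (horth : ∀ i j, i ≠ j →
      (LinearMap.BilinForm.restrict φ Wsub) (k i) (k j) = 0)
    -- ξξ*·g = 𝔞·𝔯², 𝔞 squarefree integral, 𝔯 a fractional ideal
    (𝔞 : Ideal R) (h𝔞 : Squarefree 𝔞) (𝔯 : Submodule R F) (h𝔯 : 𝔯 ≠ ⊥)
    (hξξ : Submodule.span R
        {(LinearMap.BilinForm.restrict φ Wsub) (k 0) (k 0) *
          (LinearMap.BilinForm.restrict φ Wsub) (k 1) (k 1) *
          (LinearMap.BilinForm.restrict φ Wsub) (k 2) (k 2)} =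
      idealToF R F 𝔞 * 𝔯 * 𝔯)
    -- D = the discriminant of the quaternion algebra A⁺(W): the product of the primes
    -- at which the even Clifford algebra of ψ becomes a division algebra
    (D : Ideal R)
    (hD : D = ∏ᶠ v ∈ {v : HeightOneSpectrum R |
        ∀ x : TensorProduct F (v.adicCompletion F)
          ↥(CliffordAlgebra.even (LinearMap.BilinMap.toQuadraticMap
            (LinearMap.BilinForm.restrict φ Wsub))),
          x ≠ 0 → IsUnit x}, v.asIdeal)
    -- 𝔠 = the product of the prime factors of 𝔞 prime to D
    (𝔠 : Ideal R)
    (h𝔠 : 𝔠 = ∏ᶠ v ∈ {v : HeightOneSpectrum R |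
        v.asIdeal ∣ 𝔞 ∧ ¬ v.asIdeal ∣ D}, v.asIdeal) :
    Submodule.map
      (((LinearMap.mulRight F
          (CliffordAlgebra.ι (LinearMap.BilinMap.toQuadraticMap
              (LinearMap.BilinForm.restrict φ Wsub)) (k 0) *
            CliffordAlgebra.ι (LinearMap.BilinMap.toQuadraticMap
              (LinearMap.BilinForm.restrict φ Wsub)) (k 1) *
            CliffordAlgebra.ι (LinearMap.BilinMap.toQuadraticMap
              (LinearMap.BilinForm.restrict φ Wsub)) (k 2))).comp
        (CliffordAlgebra.ι (LinearMap.BilinMap.toQuadraticMap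
          (LinearMap.BilinForm.restrict φ Wsub)))).restrictScalars R)
      (Submodule.comap ((Wsub.subtype).restrictScalars R) L) =
    idSMul R F
      (𝔯 * idealToF R F 𝔠 * idealToF R F D *
        latIdx R F ↥Wsub M (Submodule.comap ((Wsub.subtype).restrictScalars R) L))
      (normDual R F ↥Wsub (LinearMap.BilinMap.toQuadraticMap
          (LinearMap.BilinForm.restrict φ Wsub))
        (APlusSub R F ↥Wsub (LinearMap.BilinMap.toQuadraticMap
            (LinearMap.BilinForm.restrict φ Wsub))
          (Submodule.comap ((Wsub.subtype).restrictScalars R) L)) ⊓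
        minusPart R F ↥Wsub (LinearMap.BilinMap.toQuadraticMap
          (LinearMap.BilinForm.restrict φ Wsub))) := by
  subst hWsub
  have hfin : FiniteDimensional F V := Module.finite_of_finrank_eq_succ hV
  have hrank : Module.finrank F (LinearMap.ker (φ.flip h)) = 3 := by
    have := LinearMap.finrank_ker_of_ne_zero (f := φ.flip h) fun h0 => hq (by
      simpa using congrArg (fun f : V →ₗ[F] F => f h) h0)
    omega
  have : ∀ v : HeightOneSpectrum R, Finite (R ⧸ v.asIdeal) := fun v =>
    IsIntegralClosure.finite_quotient_of_int (F := F) v.ne_bot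
  exact map_ι_mul_xi_eq (IsIntegralClosure.not_isField_of_int (F := F)) hrank
    ⟨fun x y => hsymm.eq x y⟩ (hL.1.comap_subtype _) hM hk horth h𝔞 h𝔯 hξξ hD h𝔠

end Statement5
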